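/- arXiv:1708.04632 — 3 statements merged into one kernel-verified Lean document; each statement's English description precedes it below -/
import Mathlib

section
/- Let G be a connected finite simple graph of girth at least 6 that is isomorphic neither to the 7-cycle C_7 nor to the one-vertex graph K_1. Then G is well-covered if and only if the pendant edges of G form a perfect matching of G (i.e., the set of edges of G incident with a vertex of degree 1 is a set of pairwise disjoint edges covering every vertex of G). -/
/-- `s` is an independent set in `G`: no two vertices of `s` are adjacent. -/
def IndepSet {V : Type*} (G : SimpleGraph V) (s : Set V) : Prop :=
  ∀ ⦃a⦄, a ∈ s → ∀ ⦃b⦄, b ∈ s → ¬ G.Adj a b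

/-- `s` is a maximal independent set in `G`. -/
def MaxIndepSet {V : Type*} (G : SimpleGraph V) (s : Set V) : Prop :=
  IndepSet G s ∧ ∀ t : Set V, IndepSet G t → s ⊆ t → s = t

/-- `α(G)`: the maximum size of an independent set of `G`. -/
noncomputable def alphaNum {V : Type*} (G : SimpleGraph V) : ℕ :=
  sSup {n | ∃ s : Set V, IndepSet G s ∧ s.ncard = n}

/-- `i(G)`: the minimum size of a maximal independent set of `G`. -/
noncomputable def iNum {V : Type*} (G : SimpleGraph V) : ℕ :=
  sInf {n | ∃ s : Set V, MaxIndepSet G s ∧ s.ncard = n}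

/-- The independence gap `μ_α(G) = α(G) - i(G)`. -/
noncomputable def indepGap {V : Type*} (G : SimpleGraph V) : ℕ :=
  alphaNum G - iNum G

/-- `G` is well-covered: all maximal independent sets have the same size. -/
def WellCovered {V : Type*} (G : SimpleGraph V) : Prop :=
  alphaNum G = iNum G

/-- `G` is almost well-covered: its independence gap equals 1. -/
def AlmostWellCovered {V : Type*} (G : SimpleGraph V) : Prop :=
  indepGap G = 1

/-- The (open) neighborhood `N(I)` of a set of vertices `I`. -/
def nbhd {V : Type*} (G : SimpleGraph V) (I : Set V) : Set V :=
  {v | ∃ u ∈ I, G.Adj u v}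

/-- `U(G)`: the set of vertices whose connected component induces a complete graph. -/
def completeU {V : Type*} (G : SimpleGraph V) : Set V :=
  {u | G.IsClique (G.connectedComponentMk u).supp}

/-- A leaf: a vertex of the graph `G - U(G)` having degree 1 there. -/
def IsLeaf {V : Type*} (G : SimpleGraph V) (v : V) : Prop :=
  v ∉ completeU G ∧ {u | u ∉ completeU G ∧ G.Adj v u}.ncard = 1

/-- An internal vertex: a vertex of `G - U(G)` that is not a leaf. -/
def IsInternal {V : Type*} (G : SimpleGraph V) (v : V) : Prop :=
  v ∉ completeU G ∧ ¬ IsLeaf G v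

/-- A vertex has type `k` if it is an internal vertex adjacent to exactly `k` leaves;
in addition every vertex of `U(G)` has type `0`. -/
def HasType {V : Type*} (G : SimpleGraph V) (v : V) (k : ℕ) : Prop :=
  (IsInternal G v ∧ {u | IsLeaf G u ∧ G.Adj v u}.ncard = k) ∨ (v ∈ completeU G ∧ k = 0)

/-- The set of vertices of type `k`; `G_k` is the subgraph induced by this set. -/
def typeSet {V : Type*} (G : SimpleGraph V) (k : ℕ) : Set V :=
  {v | HasType G v k}

/-- The maximum number of vertices in a connected component of `G`. -/
noncomputable def maxCompCard {V : Type*} (G : SimpleGraph V) : ℕ :=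
  sSup {n | ∃ c : G.ConnectedComponent, c.supp.ncard = n}

/-- `G` has no cycle of length `n`. -/
def NoCycleOfLength {V : Type*} (G : SimpleGraph V) (n : ℕ) : Prop :=
  ∀ (v : V) (w : G.Walk v v), w.IsCycle → w.length ≠ n

/-- `G` has girth at least 6: no cycle of length 3, 4, or 5. -/
def GirthAtLeastSix {V : Type*} (G : SimpleGraph V) : Prop :=
  NoCycleOfLength G 3 ∧ NoCycleOfLength G 4 ∧ NoCycleOfLength G 5

/-- A pendant edge: an edge incident with a vertex of degree 1. -/
def pendantEdges {V : Type*} (G : SimpleGraph V) : Set (Sym2 V) :=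
  {e | e ∈ G.edgeSet ∧ ∃ v ∈ e, (G.neighborSet v).ncard = 1}

/-- The pendant edges of `G` are pairwise disjoint and cover every vertex of `G`. -/
def PendantPerfectMatching {V : Type*} (G : SimpleGraph V) : Prop :=
  (∀ e ∈ pendantEdges G, ∀ f ∈ pendantEdges G, e ≠ f → ∀ v : V, v ∈ e → v ∉ f) ∧
  (∀ v : V, ∃ e ∈ pendantEdges G, v ∈ e)

namespace SimpleGraph

variable {V : Type*} {G : SimpleGraph V}

/-- No closed walk of `G` traces a cycle of length 3, 4 or 5. In a triangle-free graph every
closed walk of length 5 is a cycle, so only length 4 needs a nondegeneracy condition. -/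
structure ShortCycleFree (G : SimpleGraph V) : Prop where
  no_three : ∀ {a b c}, G.Adj a b → G.Adj b c → G.Adj c a → False
  no_four : ∀ {a b c d}, G.Adj a b → G.Adj b c → G.Adj c d → G.Adj d a → a ≠ c → b ≠ d → False
  no_five : ∀ {a b c d e}, G.Adj a b → G.Adj b c → G.Adj c d → G.Adj d e → G.Adj e a → False

theorem shortCycleFree_of_girthAtLeastSix (hg : GirthAtLeastSix G) : ShortCycleFree G := by
  obtain ⟨g3, g4, g5⟩ := hg
  have no_three : ∀ {a b c}, G.Adj a b → G.Adj b c → G.Adj c a → False := by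
    intro a b c hab hbc hca
    refine g3 a (.cons hab (.cons hbc (.cons hca .nil))) ?_ rfl
    have := hab.ne; have := hbc.ne; have := hca.ne
    simp [Walk.isCycle_def, Walk.isTrail_def]
    grind
  refine ⟨no_three, ?_, ?_⟩
  · intro a b c d hab hbc hcd hda hac hbd
    refine g4 a (.cons hab (.cons hbc (.cons hcd (.cons hda .nil)))) ?_ rfl
    have := hab.ne; have := hbc.ne; have := hcd.ne; have := hda.ne
    simp [Walk.isCycle_def, Walk.isTrail_def]
    grind
  · intro a b c d e hab hbc hcd hde hea
    have hac : a ≠ c := by rintro rfl; exact no_three hcd hde hea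
    have hbd : b ≠ d := by rintro rfl; exact no_three hde hea hab
    have hce : c ≠ e := by rintro rfl; exact no_three hea hab hbc
    have had : a ≠ d := by rintro rfl; exact no_three hab hbc hcd
    have hbe : b ≠ e := by rintro rfl; exact no_three hbc hcd hde
    refine g5 a (.cons hab (.cons hbc (.cons hcd (.cons hde (.cons hea .nil))))) ?_ rfl
    have := hab.ne; have := hbc.ne; have := hcd.ne; have := hde.ne; have := hea.ne
    simp [Walk.isCycle_def, Walk.isTrail_def]
    grind

/-- The subgraph of `G` induced by `W` is well-covered: no independent set is larger than a
maximal independent set. -/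
def WellCoveredOn (G : SimpleGraph V) (W : Set V) : Prop :=
  ∀ I ⊆ W, IndepSet G I → (∀ w ∈ W, w ∉ I → ∃ u ∈ I, G.Adj u w) →
    ∀ J ⊆ W, IndepSet G J → J.ncard ≤ I.ncard

/-- The vertices of `W` outside the closed neighborhood of `x`. -/
def deleteClosedNbhd (G : SimpleGraph V) (W : Set V) (x : V) : Set V :=
  {w ∈ W | w ≠ x ∧ ¬ G.Adj x w}

/-- `u` is the only neighbor of `v` in `W`. -/
structure SoleNeighbor (G : SimpleGraph V) (W : Set V) (v u : V) : Prop where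
  mem : u ∈ W
  adj : G.Adj v u
  eq : ∀ w ∈ W, G.Adj v w → w = u

/-- `c` runs around a closed walk of length 7 in `W` whose vertices have no further neighbors
in `W`. -/
structure SevenCycleOn (G : SimpleGraph V) (W : Set V) (c : Fin 7 → V) : Prop where
  mem : ∀ i, c i ∈ W
  adj : ∀ i, G.Adj (c i) (c (i + 1))
  eq : ∀ i, ∀ u ∈ W, G.Adj (c i) u → u = c (i + 1) ∨ u = c (i - 1)

/-- In the subgraph induced by `W`, the vertex `v` is isolated, of degree one, adjacent to a
vertex of degree one, or on a component that is a 7-cycle. -/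
def Classified (G : SimpleGraph V) (W : Set V) (v : V) : Prop :=
  (∀ w ∈ W, ¬ G.Adj v w) ∨ (∃ u, SoleNeighbor G W v u) ∨
    (∃ l ∈ W, SoleNeighbor G W l v) ∨ ∃ c, SevenCycleOn G W c ∧ c 0 = v

theorem exists_maximal_indepSet [Finite V] {W S : Set V} (hSW : S ⊆ W) (hS : IndepSet G S) :
    ∃ I ⊆ W, S ⊆ I ∧ IndepSet G I ∧ ∀ w ∈ W, w ∉ I → ∃ u ∈ I, G.Adj u w := by
  obtain ⟨I, hSI, hI⟩ :=
    (Set.toFinite {I : Set V | I ⊆ W ∧ IndepSet G I}).exists_le_maximal ⟨hSW, hS⟩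
  refine ⟨I, hI.prop.1, hSI, hI.prop.2, fun w hw hwI => ?_⟩
  by_contra! hno
  refine hwI (hI.le_of_ge (y := insert w I) ⟨Set.insert_subset hw hI.prop.1, ?_⟩
    (Set.subset_insert w I) (Set.mem_insert w I))
  rintro a (rfl | ha) b (rfl | hb) hab
  · exact hab.ne rfl
  · exact hno b hb hab.symm
  · exact hno a ha hab
  · exact hI.prop.2 ha hb hab

theorem WellCoveredOn.deleteClosedNbhd [Finite V] {W : Set V} {x : V} (hW : WellCoveredOn G W)
    (hx : x ∈ W) : WellCoveredOn G (G.deleteClosedNbhd W x) := by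
  intro I hIW hI hdom J hJW hJ
  have insert_indep : ∀ K ⊆ G.deleteClosedNbhd W x, IndepSet G K → IndepSet G (insert x K) := by
    rintro K hKW hK a (rfl | ha) b (rfl | hb) hab
    · exact hab.ne rfl
    · exact (hKW hb).2.2 hab
    · exact (hKW ha).2.2 hab.symm
    · exact hK ha hb hab
  have not_mem : ∀ K ⊆ G.deleteClosedNbhd W x, x ∉ K := fun K hK h => (hK h).2.1 rfl
  have insert_sub : ∀ K ⊆ G.deleteClosedNbhd W x, insert x K ⊆ W := fun K hK =>
    Set.insert_subset hx fun a ha => (hK ha).1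
  have key := hW (insert x I) (insert_sub I hIW) (insert_indep I hIW hI) ?_
    (insert x J) (insert_sub J hJW) (insert_indep J hJW hJ)
  · rw [Set.ncard_insert_of_notMem (not_mem J hJW), Set.ncard_insert_of_notMem (not_mem I hIW)]
      at key
    omega
  · intro w hw hwI
    by_cases hxw : G.Adj x w
    · exact ⟨x, Set.mem_insert x I, hxw⟩
    · obtain ⟨u, hu, huw⟩ := hdom w ⟨hw, fun h => hwI (Or.inl h), hxw⟩ fun h => hwI (Or.inr h)
      exact ⟨u, Set.mem_insert_of_mem x hu, huw⟩

/-- Exchanging `m` for two of its neighbors `a` and `b` enlarges every maximal independent set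
that contains `m` and `d`. -/
theorem WellCoveredOn.false_of_exchange [Finite V] {W : Set V} (hW : WellCoveredOn G W)
    {m d a b : V} (hm : m ∈ W) (hd : d ∈ W) (ha : a ∈ W) (hb : b ∈ W) (hmd : ¬ G.Adj m d)
    (hma : G.Adj m a) (hmb : G.Adj m b) (hab : a ≠ b) (hnab : ¬ G.Adj a b)
    (hnbr : ∀ w ∈ W, G.Adj a w ∨ G.Adj b w → w = m ∨ G.Adj w d) : False := by
  obtain ⟨I, hIW, hSI, hI, hdom⟩ := exists_maximal_indepSet (G := G) (W := W) (S := {m, d})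
    (by rintro _ (rfl | rfl) <;> assumption)
    (by
      rintro _ (rfl | rfl) _ (rfl | rfl) h
      · exact h.ne rfl
      · exact hmd h
      · exact hmd h.symm
      · exact h.ne rfl)
  have hmI : m ∈ I := hSI (by simp)
  have hdI : d ∈ I := hSI (by simp)
  have haI : a ∉ I := fun h => hI hmI h hma
  have hbI : b ∉ I := fun h => hI hmI h hmb
  have hfar : ∀ w ∈ I, w ≠ m → ¬ G.Adj a w ∧ ¬ G.Adj b w := by
    intro w hw hwm
    constructor <;> intro h <;> rcases hnbr w (hIW hw) (by tauto) with h' | h' <;>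
      first | exact hwm h' | exact hI hw hdI h'
  have key := hW I hIW hI hdom (insert a (insert b (I \ {m})))
    (Set.insert_subset ha (Set.insert_subset hb (Set.sdiff_subset.trans hIW))) (by
      rintro p (rfl | rfl | hp) q (rfl | rfl | hq) h
      · exact h.ne rfl
      · exact hnab h
      · exact (hfar q hq.1 hq.2).1 h
      · exact hnab h.symm
      · exact h.ne rfl
      · exact (hfar q hq.1 hq.2).2 h
      · exact (hfar p hp.1 hp.2).1 h.symm
      · exact (hfar p hp.1 hp.2).2 h.symm
      · exact hI hp.1 hq.1 h)
  rw [Set.ncard_insert_of_notMem (by simp [hab, haI]), Set.ncard_insert_of_notMem (by simp [hbI]),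
    Set.ncard_sdiff_singleton_of_mem hmI] at key
  have : 0 < I.ncard := (Set.ncard_pos).2 ⟨m, hmI⟩
  omega

theorem WellCoveredOn.soleNeighbor_unique [Finite V] {W : Set V} (hW : WellCoveredOn G W)
    {m a b : V} (hm : m ∈ W) (ha : a ∈ W) (hb : b ∈ W) (ham : SoleNeighbor G W a m)
    (hbm : SoleNeighbor G W b m) : a = b := by
  by_contra hab
  refine hW.false_of_exchange hm hm ha hb (fun h => h.ne rfl) ham.adj.symm hbm.adj.symm hab
    (fun h => hbm.adj.ne (ham.eq b hb h)) ?_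
  rintro w hw (h | h)
  · exact Or.inl (ham.eq w hw h)
  · exact Or.inl (hbm.eq w hw h)

theorem SevenCycleOn.comp_add {W : Set V} {c : Fin 7 → V} (hc : SevenCycleOn G W c) (k : Fin 7) :
    SevenCycleOn G W fun i => c (i + k) where
  mem i := hc.mem _
  adj i := by simpa only [add_right_comm] using hc.adj (i + k)
  eq i u hu h := by simpa only [add_right_comm, add_sub_right_comm] using hc.eq (i + k) u hu h

theorem SevenCycleOn.exists_of_adj {W : Set V} {c : Fin 7 → V} (hc : SevenCycleOn G W c)
    {u v : V} (hv : c 0 = v) (hu : u ∈ W) (huv : G.Adj v u) :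
    ∃ c', SevenCycleOn G W c' ∧ c' 0 = u := by
  subst hv
  rcases hc.eq 0 u hu huv with rfl | rfl
  · exact ⟨_, hc.comp_add 1, rfl⟩
  · exact ⟨_, hc.comp_add 6, rfl⟩

theorem ShortCycleFree.seven_ne_two (hG : ShortCycleFree G) {v₀ v₁ v₂ v₃ v₄ v₅ v₆ : V}
    (_h01 : G.Adj v₀ v₁) (_h12 : G.Adj v₁ v₂) (h23 : G.Adj v₂ v₃) (h34 : G.Adj v₃ v₄)
    (h45 : G.Adj v₄ v₅) (h56 : G.Adj v₅ v₆) (h60 : G.Adj v₆ v₀) : v₀ ≠ v₂ := by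
  rintro rfl
  exact hG.no_five h23 h34 h45 h56 h60

theorem SevenCycleOn.not_soleNeighbor (hG : ShortCycleFree G) {W : Set V} {c : Fin 7 → V}
    (hc : SevenCycleOn G W c) {u v : V} (hv : c 0 = v) : ¬ SoleNeighbor G W v u := by
  subst hv
  intro h
  have h1 := h.eq _ (hc.mem 1) (hc.adj 0)
  have h6 := h.eq _ (hc.mem 6) (hc.adj 6).symm
  exact hG.seven_ne_two (hc.adj 6) (hc.adj 0) (hc.adj 1) (hc.adj 2) (hc.adj 3) (hc.adj 4)
    (hc.adj 5) (h6.trans h1.symm)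

/-- On a 7-cycle of `W` with the indicated vertices of degree two, the vertex `v₀` has no neighbor
off the cycle, provided the graph left after deleting the closed neighborhood of such a neighbor
is classified. -/
theorem ShortCycleFree.eq_of_adj_seven (hG : ShortCycleFree G) {W : Set V}
    {v₀ v₁ v₂ v₃ v₄ v₅ v₆ w : V} (m1 : v₁ ∈ W) (m2 : v₂ ∈ W) (m3 : v₃ ∈ W) (m4 : v₄ ∈ W)
    (m5 : v₅ ∈ W) (m6 : v₆ ∈ W)
    (h01 : G.Adj v₀ v₁) (h12 : G.Adj v₁ v₂) (h23 : G.Adj v₂ v₃) (h34 : G.Adj v₃ v₄)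
    (h45 : G.Adj v₄ v₅) (h56 : G.Adj v₅ v₆) (h60 : G.Adj v₆ v₀)
    (d1 : ∀ u ∈ W, G.Adj v₁ u → u = v₀ ∨ u = v₂)
    (d34 : (∀ u ∈ W, G.Adj v₃ u → u = v₂ ∨ u = v₄) ∨ (∀ u ∈ W, G.Adj v₄ u → u = v₃ ∨ u = v₅))
    (hcls : ∀ v ∈ G.deleteClosedNbhd W w, Classified G (G.deleteClosedNbhd W w) v)
    (hw : G.Adj v₀ w) : w = v₁ ∨ w = v₆ := by
  by_contra! hne
  obtain ⟨hw1, hw6⟩ := hne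
  have n02 := hG.seven_ne_two h01 h12 h23 h34 h45 h56 h60
  have n13 := hG.seven_ne_two h12 h23 h34 h45 h56 h60 h01
  have n24 := hG.seven_ne_two h23 h34 h45 h56 h60 h01 h12
  have n35 := hG.seven_ne_two h34 h45 h56 h60 h01 h12 h23
  have n46 := hG.seven_ne_two h45 h56 h60 h01 h12 h23 h34
  have n50 := hG.seven_ne_two h56 h60 h01 h12 h23 h34 h45
  have p1 : v₁ ∈ G.deleteClosedNbhd W w := ⟨m1, hw1.symm, fun h => hG.no_three h01 h.symm hw.symm⟩
  have p2 : v₂ ∈ G.deleteClosedNbhd W w :=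
    ⟨m2, fun h => hG.no_three h01 h12 (h ▸ hw.symm),
      fun h => hG.no_four h01 h12 h.symm hw.symm n02 hw1.symm⟩
  have p3 : v₃ ∈ G.deleteClosedNbhd W w :=
    ⟨m3, fun h => hG.no_four h01 h12 h23 (h ▸ hw.symm) n02 n13,
      fun h => hG.no_five h01 h12 h23 h.symm hw.symm⟩
  have p4 : v₄ ∈ G.deleteClosedNbhd W w :=
    ⟨m4, fun h => hG.no_four h45 h56 h60 (h ▸ hw) n46 n50,
      fun h => hG.no_five h h45 h56 h60 hw⟩
  have p5 : v₅ ∈ G.deleteClosedNbhd W w :=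
    ⟨m5, fun h => hG.no_three h56 h60 (h ▸ hw),
      fun h => hG.no_four h h56 h60 hw hw6 n50⟩
  have p6 : v₆ ∈ G.deleteClosedNbhd W w := ⟨m6, hw6.symm, fun h => hG.no_three h60 hw h⟩
  have l1 : SoleNeighbor G (G.deleteClosedNbhd W w) v₁ v₂ :=
    ⟨p2, h12, fun u hu h => (d1 u hu.1 h).resolve_left fun e => hu.2.2 (e ▸ hw.symm)⟩
  rcases d34 with d3 | d4
  · rcases hcls v₃ p3 with h | ⟨u, h⟩ | ⟨l, hl, h⟩ | ⟨c, hc, h⟩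
    · exact h v₂ p2 h23.symm
    · exact n24 ((h.eq _ p2 h23.symm).trans (h.eq _ p4 h34).symm)
    · rcases d3 l hl.1 h.adj.symm with rfl | rfl
      · exact n13 (h.eq _ p1 h12.symm)
      · exact n35 (h.eq _ p5 h45).symm
    · obtain ⟨c, hc, h⟩ := hc.exists_of_adj h p2 h23.symm
      obtain ⟨c, hc, h⟩ := hc.exists_of_adj h p1 h12.symm
      exact hc.not_soleNeighbor hG h l1
  · rcases hcls v₄ p4 with h | ⟨u, h⟩ | ⟨l, hl, h⟩ | ⟨c, hc, h⟩
    · exact h v₃ p3 h34.symm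
    · exact n35 ((h.eq _ p3 h34.symm).trans (h.eq _ p5 h45).symm)
    · rcases d4 l hl.1 h.adj.symm with rfl | rfl
      · exact n24 (h.eq _ p2 h23.symm)
      · exact n46 (h.eq _ p6 h56).symm
    · obtain ⟨c, hc, h⟩ := hc.exists_of_adj h p3 h34.symm
      obtain ⟨c, hc, h⟩ := hc.exists_of_adj h p2 h23.symm
      obtain ⟨c, hc, h⟩ := hc.exists_of_adj h p1 h12.symm
      exact hc.not_soleNeighbor hG h l1

/-- In a graph with minimum degree two, the second neighborhood of `x` continues along vertices of
degree two. -/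
theorem ShortCycleFree.exists_path_of_two_le_degree [Finite V] (hG : ShortCycleFree G) {W : Set V}
    (hW : WellCoveredOn G W) (hiso : ∀ v ∈ W, ∃ u ∈ W, G.Adj v u)
    (hleaf : ∀ v ∈ W, ∀ u, ¬ SoleNeighbor G W v u)
    (hcls : ∀ x ∈ W, ∀ v ∈ G.deleteClosedNbhd W x, Classified G (G.deleteClosedNbhd W x) v)
    {x y l : V} (hx : x ∈ W) (hy : y ∈ W) (hl : l ∈ W) (hxy : G.Adj x y) (hyl : G.Adj y l)
    (hlx : l ≠ x) :
    ∃ m ∈ W, ∃ m' ∈ W, ∃ l' ∈ W, ∃ y' ∈ W, G.Adj l m ∧ G.Adj m m' ∧ G.Adj m' l' ∧ G.Adj l' y' ∧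
      G.Adj y' x ∧ (∀ u ∈ W, G.Adj l u → u = y ∨ u = m) ∧
      (∀ u ∈ W, G.Adj m u → u = l ∨ u = m') ∧ l' ≠ x ∧ m' ≠ y' ∧ m ≠ l' := by
  have hWx := hW.deleteClosedNbhd hx
  have other : ∀ v ∈ W, ∀ u, ∃ w ∈ W, G.Adj v w ∧ w ≠ u := by
    intro v hv u
    by_contra! hno
    obtain ⟨w, hw, hvw⟩ := hiso v hv
    obtain rfl := hno w hw hvw
    exact hleaf v hv w ⟨hw, hvw, hno⟩
  -- Two adjacent vertices cannot both lie at distance two from `x`.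
  have far : ∀ {a b p q : V}, G.Adj a b → G.Adj x p → G.Adj p a → G.Adj x q → G.Adj q b → False :=
    fun hab hxp hpa hxq hqb => hG.no_five hxp hpa hab hqb.symm hxq.symm
  -- Vertices left after deleting the closed neighborhood of `x` see it only through `N(x)`.
  have outside : ∀ {a u : V}, a ∈ G.deleteClosedNbhd W x → u ∈ W → G.Adj a u →
      u ∈ G.deleteClosedNbhd W x ∨ G.Adj x u := by
    intro a u ha hu hau
    by_cases h : G.Adj x u
    · exact Or.inr h
    · exact Or.inl ⟨hu, fun e => ha.2.2 (e ▸ hau.symm), h⟩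
  have step : ∀ {a b : V}, a ∈ G.deleteClosedNbhd W x →
      SoleNeighbor G (G.deleteClosedNbhd W x) a b →
      ∃ p ∈ W, G.Adj x p ∧ G.Adj p a ∧ ∀ u ∈ W, G.Adj a u → u = p ∨ u = b := by
    intro a b ha hab
    obtain ⟨p, hp, hap, hpb⟩ := other a ha.1 b
    have hxp : G.Adj x p := (outside ha hp hap).resolve_left fun h => hpb (hab.eq p h hap)
    refine ⟨p, hp, hxp, hap.symm, fun u hu hau => ?_⟩
    rcases outside ha hu hau with h | h
    · exact Or.inr (hab.eq u h hau)
    · left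
      by_contra hup
      exact hG.no_four hxp hap.symm hau h.symm ha.2.1.symm (Ne.symm hup)
  have hlx' : l ∈ G.deleteClosedNbhd W x :=
    ⟨hl, hlx, fun h => hG.no_three hxy hyl h.symm⟩
  obtain ⟨m, hlm⟩ : ∃ m, SoleNeighbor G (G.deleteClosedNbhd W x) l m := by
    rcases hcls x hx l hlx' with h | h | ⟨a, ha, h⟩ | ⟨c, hc, rfl⟩
    · obtain ⟨w, hw, hlw, hwy⟩ := other l hl y
      have hxw := (outside hlx' hw hlw).resolve_left fun hw' => h w hw' hlw
      exact (hG.no_four hxy hyl hlw hxw.symm hlx.symm hwy.symm).elim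
    · exact h
    · obtain ⟨p, hp, hxp, hpa, -⟩ := step ha h
      exact (far h.adj hxp hpa hxy hyl).elim
    · have deg : ∀ i, (∃ u ∈ W, G.Adj x u ∧ G.Adj u (c i)) ∨
          ∀ u ∈ W, G.Adj (c i) u → u = c (i - 1) ∨ u = c (i + 1) := by
        intro i
        by_contra! hno
        obtain ⟨hno, u, hu, hcu, hne⟩ := hno
        rcases outside (hc.mem i) hu hcu with h | h
        · have := hc.eq i u h hcu
          tauto
        · exact hno u hu h hcu.symm
      have d1 := (deg 1).resolve_left fun ⟨u, _, hxu, hu⟩ => far (hc.adj 0) hxy hyl hxu hu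
      have d34 : (∀ u ∈ W, G.Adj (c 3) u → u = c 2 ∨ u = c 4) ∨
          ∀ u ∈ W, G.Adj (c 4) u → u = c 3 ∨ u = c 5 := by
        rcases deg 3 with ⟨u, -, hxu, hu⟩ | h
        · rcases deg 4 with ⟨u', -, hxu', hu'⟩ | h
          · exact (far (hc.adj 3) hxu hu hxu' hu').elim
          · exact Or.inr h
        · exact Or.inl h
      rcases hG.eq_of_adj_seven (hc.mem 1).1 (hc.mem 2).1 (hc.mem 3).1 (hc.mem 4).1 (hc.mem 5).1
        (hc.mem 6).1 (hc.adj 0) (hc.adj 1) (hc.adj 2) (hc.adj 3) (hc.adj 4) (hc.adj 5) (hc.adj 6)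
        d1 d34 (hcls y hy) hyl.symm with h | h
      · exact ((hc.mem 1).2.2 (h ▸ hxy)).elim
      · exact ((hc.mem 6).2.2 (h ▸ hxy)).elim
  have hm := hlm.mem
  have inside : ∀ {a b : V}, a ∈ G.deleteClosedNbhd W x → b ∈ G.deleteClosedNbhd W x →
      SoleNeighbor G (G.deleteClosedNbhd W x) a b → ∀ u ∈ W, G.Adj b u →
      u ∈ G.deleteClosedNbhd W x := by
    intro a b ha hb hab u hu hbu
    refine (outside hb hu hbu).resolve_right fun h => ?_
    obtain ⟨p, hp, hxp, hpa, -⟩ := step ha hab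
    exact far hab.adj hxp hpa h hbu.symm
  have hmy : m ∈ G.deleteClosedNbhd W y :=
    ⟨hm.1, fun e => hm.2.2 (e ▸ hxy), fun h => hG.no_three hyl hlm.adj h.symm⟩
  have mem_y : ∀ u ∈ W, G.Adj m u → u ≠ l → u ∈ G.deleteClosedNbhd W y := by
    intro u hu hmu hul
    have hu' := inside hlx' hm hlm u hu hmu
    exact ⟨hu, fun e => hu'.2.2 (e ▸ hxy), fun h =>
      hG.no_four hyl hlm.adj hmu h.symm hmy.2.1.symm hul.symm⟩
  -- Every further neighbor of `m` carries its own path back to `x`.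
  have branch : ∀ u ∈ W, G.Adj m u → u ≠ l → ∃ l' ∈ W, ∃ y' ∈ W, l' ∈ G.deleteClosedNbhd W y ∧
      G.Adj u l' ∧ G.Adj l' y' ∧ G.Adj y' x ∧ l' ≠ x ∧ m ≠ l' ∧ u ≠ y' ∧
      ∀ w ∈ W, G.Adj l' w → w = y' ∨ w = u := by
    intro u hu hmu hul
    have hu' := inside hlx' hm hlm u hu hmu
    rcases hcls x hx u hu' with h | ⟨b, h⟩ | ⟨a, ha, h⟩ | ⟨c, hc, h⟩
    · exact (h m hm hmu.symm).elim
    · obtain rfl := h.eq m hm hmu.symm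
      exact (hul (hWx.soleNeighbor_unique hm hu' hlx' h hlm)).elim
    · obtain ⟨p, hp, hxp, hpa, hdeg⟩ := step ha h
      have hay : a ∈ G.deleteClosedNbhd W y :=
        ⟨ha.1, fun e => (mem_y u hu hmu hul).2.2 (e ▸ h.adj), fun hya =>
          hG.no_five hyl hlm.adj hmu h.adj.symm hya.symm⟩
      refine ⟨a, ha.1, p, hp, hay, h.adj.symm, hpa.symm, hxp.symm, ha.2.1, ?_, ?_, hdeg⟩
      · rintro rfl
        exact far hlm.adj hxy hyl hxp hpa
      · rintro rfl
        exact hu'.2.2 hxp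
    · obtain ⟨c, hc, h⟩ := hc.exists_of_adj h hm hmu.symm
      obtain ⟨c, hc, h⟩ := hc.exists_of_adj h hlx' hlm.adj.symm
      exact (hc.not_soleNeighbor hG h hlm).elim
  have hdl : ∀ u ∈ W, G.Adj l u → u = y ∨ u = m := by
    intro u hu hlu
    rcases outside hlx' hu hlu with h | h
    · exact Or.inr (hlm.eq u h hlu)
    · left
      by_contra huy
      exact hG.no_four hxy hyl hlu h.symm hlx.symm (Ne.symm huy)
  have hdm : ∃ m' ∈ W, G.Adj m m' ∧ m' ≠ l ∧ ∀ u ∈ W, G.Adj m u → u = l ∨ u = m' := by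
    obtain ⟨m', hm', hmm', hm'l⟩ := other m hm.1 l
    refine ⟨m', hm', hmm', hm'l, ?_⟩
    rcases hcls y hy m hmy with h | ⟨b, h⟩ | ⟨a, ha, h⟩ | ⟨c, hc, rfl⟩
    · exact (h m' (mem_y m' hm' hmm' hm'l) hmm').elim
    · intro u hu hmu
      by_cases hul : u = l
      · exact Or.inl hul
      · exact Or.inr ((h.eq u (mem_y u hu hmu hul) hmu).trans
          (h.eq m' (mem_y m' hm' hmm' hm'l) hmm').symm)
    · obtain ⟨l', -, y', -, hl'y, hal', -, -, -, hne, -⟩ :=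
        branch a ha.1 h.adj.symm fun e => ha.2.2 (e ▸ hyl)
      exact (hne (h.eq l' hl'y hal').symm).elim
    · have hl_ne : ∀ i, c i ≠ l := fun i e => (hc.mem i).2.2 (e ▸ hyl)
      have h3 : G.Adj (c 3) x := by
        obtain ⟨l', -, y', -, hl'y, hal', -, hyx, -, hne, -, hdeg⟩ :=
          branch (c 1) (hc.mem 1).1 (hc.adj 0) (hl_ne 1)
        obtain rfl : l' = c 2 := (hc.eq 1 l' hl'y hal').resolve_right hne.symm
        rcases hdeg (c 3) (hc.mem 3).1 (hc.adj 2) with h | h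
        · exact h ▸ hyx
        · exact (hG.seven_ne_two (hc.adj 1) (hc.adj 2) (hc.adj 3) (hc.adj 4) (hc.adj 5) (hc.adj 6)
            (hc.adj 0) h.symm).elim
      have h4 : G.Adj (c 4) x := by
        obtain ⟨l', -, y', -, hl'y, hal', -, hyx, -, hne, -, hdeg⟩ :=
          branch (c 6) (hc.mem 6).1 (hc.adj 6).symm (hl_ne 6)
        obtain rfl : l' = c 5 := (hc.eq 6 l' hl'y hal').resolve_left hne.symm
        rcases hdeg (c 4) (hc.mem 4).1 (hc.adj 4).symm with h | h
        · exact h ▸ hyx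
        · exact (hG.seven_ne_two (hc.adj 4) (hc.adj 5) (hc.adj 6) (hc.adj 0) (hc.adj 1) (hc.adj 2)
            (hc.adj 3) h).elim
      exact (hG.no_three (hc.adj 3) h4 h3.symm).elim
  obtain ⟨m', hm', hmm', hm'l, hdm⟩ := hdm
  obtain ⟨l', hl', y', hy', -, h1, h2, h3, h4, h5, h6, -⟩ := branch m' hm' hmm' hm'l
  exact ⟨m, hm.1, m', hm', l', hl', y', hy', hlm.adj, hmm', h1, h2, h3, hdl, hdm, h4, h6, h5⟩

theorem ShortCycleFree.exists_sevenCycleOn [Finite V] (hG : ShortCycleFree G) {W : Set V}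
    (hW : WellCoveredOn G W) (hiso : ∀ v ∈ W, ∃ u ∈ W, G.Adj v u)
    (hleaf : ∀ v ∈ W, ∀ u, ¬ SoleNeighbor G W v u)
    (hcls : ∀ x ∈ W, ∀ v ∈ G.deleteClosedNbhd W x, Classified G (G.deleteClosedNbhd W x) v)
    {x : V} (hx : x ∈ W) : ∃ c, SevenCycleOn G W c ∧ c 0 = x := by
  obtain ⟨y, hy, hxy⟩ := hiso x hx
  obtain ⟨l, hl, hyl, hlx⟩ : ∃ l ∈ W, G.Adj y l ∧ l ≠ x := by
    by_contra! hno
    exact hleaf y hy x ⟨hx, hxy.symm, hno⟩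
  obtain ⟨m, hm, m', hm', l', hl', y', hy', hlm, hmm', hml', hly', hyx', dl, dm, hlx', hmy', hml⟩ :=
    hG.exists_path_of_two_le_degree hW hiso hleaf hcls hx hy hl hxy hyl hlx
  obtain ⟨a, -, b, -, -, -, -, -, -, -, -, -, -, dl', da, -, -, -⟩ :=
    hG.exists_path_of_two_le_degree hW hiso hleaf hcls hx hy' hl' hyx'.symm hly'.symm hlx'
  obtain rfl : m' = a := (dl' m' hm' hml'.symm).resolve_left hmy'
  obtain rfl : m = b := (da m hm hmm'.symm).resolve_left hml
  have dy : ∀ u ∈ W, G.Adj y u → u = l ∨ u = x := fun u hu h =>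
    hG.eq_of_adj_seven hl hm hm' hl' hy' hx hyl hlm hmm' hml' hly' hyx' hxy dl
      (Or.inl fun u hu h => (da u hu h).symm) (hcls u hu) h
  have dy' : ∀ u ∈ W, G.Adj y' u → u = l' ∨ u = x := fun u hu h =>
    hG.eq_of_adj_seven hl' hm' hm hl hy hx hly'.symm hml'.symm hmm'.symm hlm.symm hyl.symm
      hxy.symm hyx'.symm dl' (Or.inl fun u hu h => (dm u hu h).symm) (hcls u hu) h
  have dx : ∀ u ∈ W, G.Adj x u → u = y ∨ u = y' := fun u hu h =>
    hG.eq_of_adj_seven hy hl hm hm' hl' hy' hxy hyl hlm hmm' hml' hly' hyx'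
      (fun u hu h => (dy u hu h).symm) (Or.inl dm) (hcls u hu) h
  refine ⟨![x, y, l, m, m', l', y'], ⟨?_, ?_, ?_⟩, rfl⟩
  · intro i; fin_cases i <;> assumption
  · intro i; fin_cases i <;> assumption
  · intro i u hu h
    fin_cases i
    · exact dx u hu h
    · exact dy u hu h
    · exact (dl u hu h).symm
    · exact (dm u hu h).symm
    · exact da u hu h
    · exact dl' u hu h
    · exact (dy' u hu h).symm

/-- Reinserting a vertex `l` of degree one and its neighbor `m` preserves the classification. -/
theorem ShortCycleFree.classified_of_soleNeighbor [Finite V] (hG : ShortCycleFree G) {W : Set V}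
    (hW : WellCoveredOn G W)
    (hcls : ∀ x ∈ W, ∀ v ∈ G.deleteClosedNbhd W x, Classified G (G.deleteClosedNbhd W x) v)
    {l m : V} (hl : l ∈ W) (hlm : SoleNeighbor G W l m) {v : V} (hv : v ∈ W) :
    Classified G W v := by
  by_cases hvl : v = l
  · exact hvl ▸ Or.inr (Or.inl ⟨m, hlm⟩)
  by_cases hvm : v = m
  · exact hvm ▸ Or.inr (Or.inr (Or.inl ⟨l, hl, hlm⟩))
  have mem : ∀ u ∈ W, u ≠ l → u ≠ m → u ∈ G.deleteClosedNbhd W l := fun u hu hul hum =>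
    ⟨hu, hul, fun h => hum (hlm.eq u hu h)⟩
  have ne_m : ∀ {a}, a ∈ G.deleteClosedNbhd W l → a ≠ m := fun ha e => ha.2.2 (e ▸ hlm.adj)
  have nbr : ∀ {a u}, a ∈ G.deleteClosedNbhd W l → u ∈ W → G.Adj a u →
      u = m ∨ u ∈ G.deleteClosedNbhd W l := by
    intro a u ha hu hau
    by_cases hum : u = m
    · exact Or.inl hum
    · exact Or.inr (mem u hu (fun e => ne_m ha (hlm.eq a ha.1 (e ▸ hau.symm))) hum)
  have pair : ∀ {b c}, b ∈ G.deleteClosedNbhd W l → SoleNeighbor G (G.deleteClosedNbhd W l) b c →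
      SoleNeighbor G W b c ∨ SoleNeighbor G W c b := by
    intro b c hb hbc
    by_cases hbm : G.Adj b m
    · right
      refine ⟨hb.1, hbc.adj.symm, fun d hd hcd => ?_⟩
      by_contra hdb
      refine hW.false_of_exchange hlm.mem hd hl hb.1 (fun h => ?_) hlm.adj.symm hbm.symm
        hb.2.1.symm hb.2.2 ?_
      · exact hG.no_four hbm.symm hbc.adj hcd h.symm (ne_m hbc.mem).symm (Ne.symm hdb)
      · rintro w hw (h | h)
        · exact Or.inl (hlm.eq w hw h)
        · rcases nbr hb hw h with rfl | hw'
          · exact Or.inl rfl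
          · exact Or.inr (hbc.eq w hw' h ▸ hcd)
    · left
      refine ⟨hbc.mem.1, hbc.adj, fun w hw h => ?_⟩
      rcases nbr hb hw h with rfl | hw'
      · exact (hbm h).elim
      · exact hbc.eq w hw' h
  have hv' := mem v hv hvl hvm
  rcases hcls l hl v hv' with h | ⟨u, h⟩ | ⟨b, hb, h⟩ | ⟨c, hc, rfl⟩
  · by_cases hadj : G.Adj v m
    · exact Or.inr (Or.inl ⟨m, hlm.mem, hadj, fun w hw hvw =>
        (nbr hv' hw hvw).resolve_right fun hw' => h w hw' hvw⟩)
    · refine Or.inl fun w hw hvw => ?_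
      rcases nbr hv' hw hvw with rfl | hw'
      · exact hadj hvw
      · exact h w hw' hvw
  · rcases pair hv' h with h' | h'
    · exact Or.inr (Or.inl ⟨u, h'⟩)
    · exact Or.inr (Or.inr (Or.inl ⟨u, h.mem.1, h'⟩))
  · rcases pair hb h with h | h
    · exact Or.inr (Or.inr (Or.inl ⟨b, hb.1, h⟩))
    · exact Or.inr (Or.inl ⟨b, h⟩)
  · have deg : ∀ {c}, SevenCycleOn G (G.deleteClosedNbhd W l) c → ¬ G.Adj (c 0) m := by
      intro c hc h
      have d1 : ∀ u ∈ W, G.Adj (c 1) u → u = c 0 ∨ u = c 2 := by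
        intro u hu hcu
        rcases nbr (hc.mem 1) hu hcu with rfl | hu'
        · exact (hG.no_three (hc.adj 0) hcu h.symm).elim
        · exact (hc.eq 1 u hu' hcu).symm
      have d3 : ∀ u ∈ W, G.Adj (c 3) u → u = c 2 ∨ u = c 4 := by
        intro u hu hcu
        rcases nbr (hc.mem 3) hu hcu with rfl | hu'
        · exact (hG.no_five (hc.adj 0) (hc.adj 1) (hc.adj 2) hcu h.symm).elim
        · exact (hc.eq 3 u hu' hcu).symm
      rcases hG.eq_of_adj_seven (hc.mem 1).1 (hc.mem 2).1 (hc.mem 3).1 (hc.mem 4).1 (hc.mem 5).1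
        (hc.mem 6).1 (hc.adj 0) (hc.adj 1) (hc.adj 2) (hc.adj 3) (hc.adj 4) (hc.adj 5) (hc.adj 6)
        d1 (Or.inl d3) (hcls m hlm.mem) h with h | h
      · exact ne_m (hc.mem 1) h.symm
      · exact ne_m (hc.mem 6) h.symm
    refine Or.inr (Or.inr (Or.inr ⟨c, ⟨fun i => (hc.mem i).1, hc.adj, fun i u hu hcu => ?_⟩, rfl⟩))
    rcases nbr (hc.mem i) hu hcu with rfl | hu'
    · exact (deg (hc.comp_add i) (by simpa using hcu)).elim
    · exact hc.eq i u hu' hcu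

theorem ShortCycleFree.classified [Finite V] (hG : ShortCycleFree G) {W : Set V}
    (hW : WellCoveredOn G W) {v : V} (hv : v ∈ W) : Classified G W v := by
  induction hn : W.ncard using Nat.strong_induction_on generalizing W v with
  | _ n ih =>
    have hcls : ∀ x ∈ W, ∀ v ∈ G.deleteClosedNbhd W x,
        Classified G (G.deleteClosedNbhd W x) v := by
      intro x hx v hv
      refine ih _ ?_ (hW.deleteClosedNbhd hx) hv rfl
      rw [← hn]
      exact Set.ncard_lt_ncard ⟨fun w hw => hw.1, fun h => (h hx).2.1 rfl⟩
    by_cases hleaf : ∃ l ∈ W, ∃ m, SoleNeighbor G W l m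
    · obtain ⟨l, hl, m, hlm⟩ := hleaf
      exact hG.classified_of_soleNeighbor hW hcls hl hlm hv
    push Not at hleaf
    by_cases hiso : ∃ x ∈ W, ∀ u ∈ W, ¬ G.Adj x u
    · obtain ⟨x, hx, hiso⟩ := hiso
      have nbr : ∀ {a u}, a ∈ W → u ∈ W → G.Adj a u → u ∈ G.deleteClosedNbhd W x :=
        fun ha hu hau => ⟨hu, fun e => hiso _ ha (e ▸ hau.symm), hiso _ hu⟩
      by_cases hvx : v = x
      · exact Or.inl (hvx ▸ hiso)
      · rcases hcls x hx v ⟨hv, hvx, hiso v hv⟩ with h | ⟨u, h⟩ | ⟨b, hb, h⟩ | ⟨c, hc, rfl⟩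
        · exact Or.inl fun w hw hvw => h w (nbr hv hw hvw) hvw
        · exact (hleaf v hv u ⟨h.mem.1, h.adj, fun w hw hvw => h.eq w (nbr hv hw hvw) hvw⟩).elim
        · exact (hleaf b hb.1 v ⟨hv, h.adj, fun w hw hbw => h.eq w (nbr hb.1 hw hbw) hbw⟩).elim
        · exact Or.inr (Or.inr (Or.inr ⟨c, ⟨fun i => (hc.mem i).1, hc.adj, fun i u hu hcu =>
            hc.eq i u (nbr (hc.mem i).1 hu hcu) hcu⟩, rfl⟩))
    push Not at hiso
    exact Or.inr (Or.inr (Or.inr (hG.exists_sevenCycleOn hW hiso hleaf hcls hv)))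

theorem SevenCycleOn.injective (hG : ShortCycleFree G) {W : Set V} {c : Fin 7 → V}
    (hc : SevenCycleOn G W c) : Function.Injective c := by
  have ne_one : ∀ i, c i ≠ c (i + 1) := fun i => (hc.adj i).ne
  have ne_two : ∀ i, c i ≠ c (i + 2) := by
    intro i
    have h := hc.comp_add i
    have := hG.seven_ne_two (h.adj 0) (h.adj 1) (h.adj 2) (h.adj 3) (h.adj 4) (h.adj 5) (h.adj 6)
    simpa [add_comm] using this
  have ne_three : ∀ i, c i ≠ c (i + 3) := by
    intro i e
    have h := hc.comp_add i
    refine hG.no_three (h.adj 0) (h.adj 1) (c := c (2 + i)) ?_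
    have := h.adj 2
    simp only [show (2 : Fin 7) + 1 = 3 from rfl, add_comm 3 i, ← e] at this
    simpa using this
  intro i j hij
  by_contra hne
  have key : ∀ i j : Fin 7, i ≠ j → j = i + 1 ∨ j = i + 2 ∨ j = i + 3 ∨
      i = j + 1 ∨ i = j + 2 ∨ i = j + 3 := by decide
  rcases key i j hne with rfl | rfl | rfl | rfl | rfl | rfl
  · exact ne_one _ hij
  · exact ne_two _ hij
  · exact ne_three _ hij
  · exact ne_one _ hij.symm
  · exact ne_two _ hij.symm
  · exact ne_three _ hij.symm

/-- A nonempty set of vertices of a connected graph that is closed under adjacency is everything. -/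
theorem Connected.mem_of_adj_closed (hconn : G.Connected) {s : Set V} {v : V} (hv : v ∈ s)
    (hs : ∀ a ∈ s, ∀ b, G.Adj a b → b ∈ s) (u : V) : u ∈ s := by
  obtain ⟨w⟩ := hconn.preconnected v u
  induction w with
  | nil => exact hv
  | cons h _ ih => exact ih (hs _ hv _ h)

theorem SevenCycleOn.nonempty_iso_cycleGraph (hG : ShortCycleFree G) (hconn : G.Connected)
    {c : Fin 7 → V} (hc : SevenCycleOn G Set.univ c) : Nonempty (G ≃g cycleGraph 7) := by
  have hsurj : Function.Surjective c := fun u =>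
    hconn.mem_of_adj_closed (s := Set.range c) (Set.mem_range_self 0) (by
      rintro _ ⟨i, rfl⟩ b hb
      rcases hc.eq i b trivial hb with rfl | rfl <;> exact Set.mem_range_self _) u
  have hinj := hc.injective hG
  refine ⟨(RelIso.symm ⟨Equiv.ofBijective c ⟨hinj, hsurj⟩, ?_⟩ : G ≃g cycleGraph 7)⟩
  intro i j
  change G.Adj (c i) (c j) ↔ _
  rw [cycleGraph_adj]
  constructor
  · intro h
    rcases hc.eq i (c j) trivial h with e | e <;> obtain rfl := hinj e <;> simp
  · rintro (h | h)
    · obtain rfl := sub_eq_iff_eq_add'.1 h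
      exact (hc.adj j).symm
    · obtain rfl := sub_eq_iff_eq_add'.1 h
      exact hc.adj i

theorem nonempty_iso_top_of_isolated (hconn : G.Connected) {v : V} (hv : ∀ w, ¬ G.Adj v w) :
    Nonempty (G ≃g (⊤ : SimpleGraph (Fin 1))) := by
  have hall : ∀ u, u = v := hconn.mem_of_adj_closed (s := {v}) rfl fun a ha b hab =>
    (hv b (ha ▸ hab)).elim
  have : Unique V := ⟨⟨v⟩, hall⟩
  refine ⟨⟨Equiv.ofUnique V (Fin 1), ?_⟩⟩
  intro a b
  simp [Subsingleton.elim a b]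

theorem maxIndepSet_iff {I : Set V} :
    MaxIndepSet G I ↔ IndepSet G I ∧ ∀ w, w ∉ I → ∃ u ∈ I, G.Adj u w := by
  refine and_congr_right fun hI => ⟨fun h w hw => ?_, fun h t ht hIt => ?_⟩
  · by_contra! hno
    refine hw ?_
    rw [h (insert w I) ?_ (Set.subset_insert w I)]
    · exact Set.mem_insert w I
    · rintro a (rfl | ha) b (rfl | hb) hab
      · exact hab.ne rfl
      · exact hno b hb hab.symm
      · exact hno a ha hab
      · exact hI ha hb hab
  · refine hIt.antisymm fun w hw => ?_
    by_contra hwI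
    obtain ⟨u, hu, huw⟩ := h w hwI
    exact ht (hIt hu) hw huw

theorem wellCovered_iff_wellCoveredOn_univ [Finite V] :
    WellCovered G ↔ WellCoveredOn G Set.univ := by
  have bdd : BddAbove {n | ∃ s : Set V, IndepSet G s ∧ s.ncard = n} :=
    ⟨Nat.card V, by rintro _ ⟨s, -, rfl⟩; exact Set.ncard_le_card s⟩
  obtain ⟨I₀, -, -, hI₀, hdom₀⟩ :=
    exists_maximal_indepSet (G := G) (Set.empty_subset Set.univ) fun a ha => ha.elim
  have hmax₀ : MaxIndepSet G I₀ := maxIndepSet_iff.2 ⟨hI₀, fun w => hdom₀ w trivial⟩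
  constructor
  · intro h I _ hI hdom J _ hJ
    calc J.ncard ≤ alphaNum G := le_csSup bdd ⟨J, hJ, rfl⟩
      _ = iNum G := h
      _ ≤ I.ncard := Nat.sInf_le ⟨I, maxIndepSet_iff.2 ⟨hI, fun w => hdom w trivial⟩, rfl⟩
  · intro h
    refine le_antisymm ?_ ?_
    · refine csSup_le ⟨_, I₀, hI₀, rfl⟩ ?_
      rintro _ ⟨J, hJ, rfl⟩
      refine le_csInf ⟨_, I₀, hmax₀, rfl⟩ ?_
      rintro _ ⟨I, hI, rfl⟩
      obtain ⟨hI, hdom⟩ := maxIndepSet_iff.1 hI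
      exact h I (Set.subset_univ I) hI (fun w _ => hdom w) J (Set.subset_univ J) hJ
    · calc iNum G ≤ I₀.ncard := Nat.sInf_le ⟨I₀, hmax₀, rfl⟩
        _ ≤ alphaNum G := le_csSup bdd ⟨I₀, hI₀, rfl⟩

theorem mem_pendantEdges_iff {e : Sym2 V} :
    e ∈ pendantEdges G ↔ ∃ l m, SoleNeighbor G Set.univ l m ∧ e = s(l, m) := by
  constructor
  · rintro ⟨he, l, hl, hcard⟩
    obtain ⟨m, rfl⟩ := hl
    obtain ⟨u, hu⟩ := Set.ncard_eq_one.1 hcard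
    have hlm : G.Adj l m := he
    have eq : ∀ w, G.Adj l w → w = u := fun w hw => by
      have : w ∈ G.neighborSet l := hw
      rwa [hu] at this
    exact ⟨l, m, ⟨trivial, hlm, fun w _ hw => (eq w hw).trans (eq m hlm).symm⟩, rfl⟩
  · rintro ⟨l, m, h, rfl⟩
    refine ⟨h.adj, l, Sym2.mem_mk_left l m, Set.ncard_eq_one.2 ⟨m, ?_⟩⟩
    ext w
    exact ⟨h.eq w trivial, fun hw => hw ▸ h.adj⟩

theorem wellCoveredOn_univ_of_pendantPerfectMatching [Finite V] (h : PendantPerfectMatching G) :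
    WellCoveredOn G Set.univ := by
  obtain ⟨hdisj, hcover⟩ := h
  intro I _ hI hdom J _ hJ
  choose e he hve using hcover
  have hmeet : ∀ v, ∃ u ∈ I, u ∈ e v := by
    intro v
    obtain ⟨l, m, hlm, heq⟩ := mem_pendantEdges_iff.1 (he v)
    rw [heq]
    by_cases hl : l ∈ I
    · exact ⟨l, hl, Sym2.mem_mk_left l m⟩
    · obtain ⟨u, hu, hul⟩ := hdom l trivial hl
      exact ⟨u, hu, hlm.eq u trivial hul.symm ▸ Sym2.mem_mk_right l u⟩
  choose f hfI hfe using hmeet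
  refine Set.ncard_le_ncard_of_injOn f (fun v _ => hfI v) ?_
  intro a ha b hb hab
  have heq : e a = e b := by
    by_contra hne
    exact hdisj _ (he a) _ (he b) hne (f a) (hfe a) (hab ▸ hfe b)
  by_contra hne
  have hadj : e a = s(a, b) := (Sym2.mem_and_mem_iff hne).1 ⟨hve a, heq ▸ hve b⟩
  have := (he a).1
  rw [hadj] at this
  exact hJ ha hb this

theorem WellCoveredOn.pendantPerfectMatching [Finite V] (hW : WellCoveredOn G Set.univ)
    (hcover : ∀ v, (∃ u, SoleNeighbor G Set.univ v u) ∨ ∃ l, SoleNeighbor G Set.univ l v) :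
    PendantPerfectMatching G := by
  refine ⟨fun e he f hf hne v hve hvf => hne ?_, fun v => ?_⟩
  · obtain ⟨l, m, h, rfl⟩ := mem_pendantEdges_iff.1 he
    obtain ⟨l', m', h', rfl⟩ := mem_pendantEdges_iff.1 hf
    rcases Sym2.mem_iff.1 hve with rfl | rfl <;> rcases Sym2.mem_iff.1 hvf with rfl | rfl
    · rw [h.eq m' trivial h'.adj]
    · rw [h.eq l' trivial h'.adj.symm, Sym2.eq_swap]
    · rw [h'.eq l trivial h.adj.symm, Sym2.eq_swap]
    · rw [hW.soleNeighbor_unique trivial trivial trivial h h']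
  · rcases hcover v with ⟨u, h⟩ | ⟨l, h⟩
    · exact ⟨s(v, u), mem_pendantEdges_iff.2 ⟨v, u, h, rfl⟩, Sym2.mem_mk_left v u⟩
    · exact ⟨s(l, v), mem_pendantEdges_iff.2 ⟨l, v, h, rfl⟩, Sym2.mem_mk_right l v⟩

end SimpleGraph

/-- A connected graph of girth at least 6, isomorphic neither to `C₇` nor
to `K₁`, is well-covered iff its pendant edges form a perfect matching. -/
theorem wellCovered_iff_pendant_perfect_matching {V : Type*} [Fintype V] (G : SimpleGraph V)
    (hconn : G.Connected) (hg : GirthAtLeastSix G)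
    (hC7 : IsEmpty (G ≃g SimpleGraph.cycleGraph 7))
    (hK1 : IsEmpty (G ≃g (⊤ : SimpleGraph (Fin 1)))) :
    WellCovered G ↔ PendantPerfectMatching G := by
  rw [SimpleGraph.wellCovered_iff_wellCoveredOn_univ]
  refine ⟨fun hW => hW.pendantPerfectMatching fun v => ?_,
    SimpleGraph.wellCoveredOn_univ_of_pendantPerfectMatching⟩
  have hG := SimpleGraph.shortCycleFree_of_girthAtLeastSix hg
  rcases hG.classified hW (Set.mem_univ v) with h | h | ⟨l, -, h⟩ | ⟨c, hc, -⟩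
  · exact (not_nonempty_iff.2 hK1
      (SimpleGraph.nonempty_iso_top_of_isolated hconn fun w => h w trivial)).elim
  · exact Or.inl h
  · exact Or.inr ⟨l, h⟩
  · exact (not_nonempty_iff.2 hC7 (hc.nonempty_iso_cycleGraph hG hconn)).elim
end

section
/- Let G be an almost well-covered finite simple graph of girth at least 6. Then no vertex of type 2 of G is adjacent to a vertex of type 0 of G. -/
/-- Adjacent vertices are both in `U(G)` or both outside it. -/
theorem mem_completeU_of_adj {V : Type*} {G : SimpleGraph V} {a b : V} (hab : G.Adj a b)
    (ha : a ∈ completeU G) : b ∈ completeU G := by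
  have hc : G.connectedComponentMk a = G.connectedComponentMk b :=
    SimpleGraph.ConnectedComponent.sound hab.reachable
  simpa only [completeU, Set.mem_ofPred_eq, hc] using ha

/-- A neighbor of a leaf is its only neighbor. -/
theorem IsLeaf.eq_of_adj {V : Type*} {G : SimpleGraph V} {l a b : V} (hl : IsLeaf G l)
    (ha : G.Adj l a) (hb : G.Adj l b) : a = b := by
  obtain ⟨c, hc⟩ := Set.ncard_eq_one.mp hl.2
  have key : ∀ x, G.Adj l x → x = c := fun x hx => by
    have : x ∈ {u | u ∉ completeU G ∧ G.Adj l u} :=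
      ⟨fun hU => hl.1 (mem_completeU_of_adj hx.symm hU), hx⟩
    rwa [hc] at this
  rw [key a ha, key b hb]

/-- A non-leaf outside `U(G)` with a neighbor `w` has a second neighbor. -/
theorem exists_adj_ne_of_not_isLeaf {V : Type*} {G : SimpleGraph V} {u w : V}
    (hU : w ∉ completeU G) (hu : ¬ IsLeaf G u) (huw : G.Adj u w) :
    ∃ x, G.Adj u x ∧ x ≠ w := by
  by_contra! hx
  refine hu ⟨fun h => hU (mem_completeU_of_adj huw h), Set.ncard_eq_one.mpr ⟨w, ?_⟩⟩
  ext y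
  constructor
  · exact fun hy => hx y hy.2
  · rintro rfl
    exact ⟨hU, huw⟩

theorem NoCycleOfLength.not_triangle {V : Type*} {G : SimpleGraph V} (h : NoCycleOfLength G 3)
    {a b c : V} (hab : G.Adj a b) (hbc : G.Adj b c) : ¬ G.Adj c a := by
  intro hca
  refine h a (.cons hab (.cons hbc (.cons hca .nil))) ?_ rfl
  have := hab.ne
  have := hbc.ne
  have := hca.ne
  simp [SimpleGraph.Walk.cons_isCycle_iff, SimpleGraph.Walk.cons_isPath_iff]
  grind

theorem NoCycleOfLength.not_square {V : Type*} {G : SimpleGraph V} (h : NoCycleOfLength G 4)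
    {a b c d : V} (hab : G.Adj a b) (hbc : G.Adj b c) (hcd : G.Adj c d)
    (hac : a ≠ c) (hbd : b ≠ d) : ¬ G.Adj d a := by
  intro hda
  refine h a (.cons hab (.cons hbc (.cons hcd (.cons hda .nil)))) ?_ rfl
  have := hab.ne
  have := hbc.ne
  have := hcd.ne
  have := hda.ne
  simp [SimpleGraph.Walk.cons_isCycle_iff, SimpleGraph.Walk.cons_isPath_iff]
  grind

theorem NoCycleOfLength.not_pentagon {V : Type*} {G : SimpleGraph V} (h : NoCycleOfLength G 5)
    {a b c d e : V} (hab : G.Adj a b) (hbc : G.Adj b c) (hcd : G.Adj c d) (hde : G.Adj d e)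
    (hac : a ≠ c) (had : a ≠ d) (hbd : b ≠ d) (hbe : b ≠ e) (hce : c ≠ e) : ¬ G.Adj e a := by
  intro hea
  refine h a (.cons hab (.cons hbc (.cons hcd (.cons hde (.cons hea .nil))))) ?_ rfl
  have := hab.ne
  have := hbc.ne
  have := hcd.ne
  have := hde.ne
  have := hea.ne
  simp [SimpleGraph.Walk.cons_isCycle_iff, SimpleGraph.Walk.cons_isPath_iff]
  grind

theorem IndepSet.exists_maxIndepSet {V : Type*} [Finite V] {G : SimpleGraph V} {s : Set V}
    (hs : IndepSet G s) : ∃ t, MaxIndepSet G t ∧ s ⊆ t := by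
  obtain ⟨t, hst, ht⟩ := (Set.toFinite {t : Set V | IndepSet G t}).exists_le_maximal hs
  exact ⟨t, ⟨ht.prop, fun u hu htu => ht.eq_of_le hu htu⟩, hst⟩

theorem IndepSet.ncard_le_alphaNum {V : Type*} [Finite V] {G : SimpleGraph V} {s : Set V}
    (hs : IndepSet G s) : s.ncard ≤ alphaNum G := by
  refine le_csSup ⟨Nat.card V, ?_⟩ ⟨s, hs, rfl⟩
  rintro _ ⟨t, -, rfl⟩
  exact Set.ncard_le_card t

theorem MaxIndepSet.iNum_le_ncard {V : Type*} {G : SimpleGraph V} {s : Set V}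
    (hs : MaxIndepSet G s) : iNum G ≤ s.ncard :=
  Nat.sInf_le ⟨s, hs, rfl⟩

/-- In a graph of girth at least 6, if no neighbor of `w` is a leaf and `v` is a neighbor of `w`,
some maximal independent set meets the neighborhood of `w` only in `v`. -/
theorem exists_maxIndepSet_of_adj {V : Type*} [Finite V] {G : SimpleGraph V}
    (hg : GirthAtLeastSix G) {v w : V} (hvw : G.Adj v w) (hU : w ∉ completeU G)
    (hw : ∀ u, G.Adj w u → ¬ IsLeaf G u) :
    ∃ s, MaxIndepSet G s ∧ v ∈ s ∧ ∀ u ∈ s, G.Adj w u → u = v := by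
  obtain ⟨h3, h4, h5⟩ := hg
  have hex : ∀ u, ∃ x, G.Adj w u → G.Adj u x ∧ x ≠ w := fun u => by
    by_cases hu : G.Adj w u
    · obtain ⟨x, hx⟩ := exists_adj_ne_of_not_isLeaf hU (hw u hu) hu.symm
      exact ⟨x, fun _ => hx⟩
    · exact ⟨u, fun h => absurd h hu⟩
  choose f hf using hex
  have hfv : ∀ u, G.Adj w u → u ≠ v → ¬ G.Adj v (f u) := fun u hu huv hadj =>
    h4.not_square hadj (hf u hu).1.symm hu.symm huv.symm (hf u hu).2 hvw.symm
  have hff : ∀ u u', G.Adj w u → G.Adj w u' → ¬ G.Adj (f u) (f u') := by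
    intro u u' hu hu' hadj
    rcases eq_or_ne u u' with rfl | hne
    · exact hadj.ne rfl
    refine h5.not_pentagon hu (hf u hu).1 hadj (hf u' hu').1.symm (hf u hu).2.symm
      (hf u' hu').2.symm ?_ hne ?_ hu'.symm
    · intro he
      exact h3.not_triangle hu' (he ▸ (hf u' hu').1) hu.symm
    · intro he
      exact h3.not_triangle hu (he ▸ (hf u hu).1) hu'.symm
  have hS : IndepSet G (insert v (f '' {u | G.Adj w u ∧ u ≠ v})) := by
    rintro a (rfl | ⟨u, ⟨hu, huv⟩, rfl⟩) b (rfl | ⟨u', ⟨hu', huv'⟩, rfl⟩)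
    · exact G.loopless.irrefl _
    · exact hfv u' hu' huv'
    · exact fun hadj => hfv u hu huv hadj.symm
    · exact hff u u' hu hu'
  obtain ⟨s, hs, hSs⟩ := hS.exists_maxIndepSet
  refine ⟨s, hs, hSs (Set.mem_insert _ _), fun u hus hwu => ?_⟩
  by_contra huv
  exact hs.1 hus (hSs (Set.mem_insert_of_mem _ ⟨u, ⟨hwu, huv⟩, rfl⟩)) (hf u hwu).1

/-- In an almost well-covered graph of girth at least 6, no vertex of type 2
is adjacent to a vertex of type 0. -/
theorem no_edge_type2_type0 {V : Type*} [Fintype V] (G : SimpleGraph V)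
    (h : AlmostWellCovered G) (hg : GirthAtLeastSix G)
    (v w : V) (hv : HasType G v 2) (hw : HasType G w 0) :
    ¬ G.Adj v w := by
  intro hvw
  obtain ⟨hvi, hv2⟩ : IsInternal G v ∧ {u | IsLeaf G u ∧ G.Adj v u}.ncard = 2 := by
    simpa [HasType] using hv
  have hwU : w ∉ completeU G := fun hU => hvi.1 (mem_completeU_of_adj hvw.symm hU)
  obtain ⟨hwi, hw0⟩ : IsInternal G w ∧ {u | IsLeaf G u ∧ G.Adj w u}.ncard = 0 :=
    hw.resolve_right fun hU => hwU hU.1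
  have hwl : ∀ u, G.Adj w u → ¬ IsLeaf G u := fun u hu hl => by
    rw [Set.ncard_eq_zero] at hw0
    exact Set.eq_empty_iff_forall_notMem.mp hw0 u ⟨hl, hu⟩
  obtain ⟨l₁, l₂, hl, hL⟩ := Set.ncard_eq_two.mp hv2
  obtain ⟨hl₁, hvl₁⟩ : l₁ ∈ {u | IsLeaf G u ∧ G.Adj v u} := by simp [hL]
  obtain ⟨hl₂, hvl₂⟩ : l₂ ∈ {u | IsLeaf G u ∧ G.Adj v u} := by simp [hL]
  obtain ⟨s, hs, hvs, hws⟩ := exists_maxIndepSet_of_adj hg hvw hwU hwl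
  have hn : ∀ {x}, G.Adj v x → x ∉ s := fun hx hxs => hs.1 hvs hxs hx
  have hwl₁ : w ≠ l₁ := fun he => hwi.2 (he ▸ hl₁)
  have hwl₂ : w ≠ l₂ := fun he => hwi.2 (he ▸ hl₂)
  have e₁ : ∀ b, G.Adj l₁ b → b = v := fun b hb => hl₁.eq_of_adj hb hvl₁.symm
  have e₂ : ∀ b, G.Adj l₂ b → b = v := fun b hb => hl₂.eq_of_adj hb hvl₂.symm
  have hJ : IndepSet G (insert w (insert l₁ (insert l₂ (s \ {v})))) := by
    have := hvw.ne
    have := hvl₁.ne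
    have := hvl₂.ne
    intro a ha b hb hab
    have hba := hab.symm
    simp only [Set.mem_insert_iff, Set.mem_sdiff, Set.mem_singleton_iff] at ha hb
    have := @hs.1 a
    grind [G.loopless.irrefl w]
  have hcard : (insert w (insert l₁ (insert l₂ (s \ {v})))).ncard = s.ncard + 2 := by
    rw [Set.ncard_insert_of_notMem, Set.ncard_insert_of_notMem, Set.ncard_insert_of_notMem,
      ← Set.ncard_sdiff_singleton_add_one hvs]
    · exact fun hx => hn hvl₂ hx.1
    · rintro (hx | hx)
      exacts [hl hx, hn hvl₁ hx.1]
    · rintro (hx | hx | hx)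
      exacts [hwl₁ hx, hwl₂ hx, hn hvw hx.1]
  have h₁ := hJ.ncard_le_alphaNum
  have h₂ := hs.iNum_le_ncard
  unfold AlmostWellCovered indepGap at h
  omega
end

section
/- Let G be a finite simple graph of girth at least 6, with exactly one vertex x of type 2, and with no vertices of type k for any k ≥ 3. Then G is almost well-covered if and only if every internal vertex of G other than x is of type 0 or type 1, no neighbor of x lies in V(G_0), G_0 is well-covered, and for every independent set I of G contained in V(G_1) the following hold: (a) if I ∩ N(x) = ∅ then α(G_0) = i(G_0 − N(I)); and (b) if I ∩ N(x) ≠ ∅ then α(G_0) − i(G_0 − N(I)) ≤ 1. Here N(I) is the neighborhood of I in G and G_0 − N(I) is the subgraph of G induced on V(G_0) ∖ N(I). -/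
section Girth

variable {V : Type*} {G : SimpleGraph V}

lemma no_triangle (h : NoCycleOfLength G 3) {a b c : V}
    (hab : G.Adj a b) (hbc : G.Adj b c) (hca : G.Adj c a) : False := by
  refine h a (.cons hab (.cons hbc (.cons hca .nil))) ?_ rfl
  have := hab.ne
  have := hbc.ne
  have := hca.ne
  simp only [SimpleGraph.Walk.cons_isCycle_iff, SimpleGraph.Walk.cons_isPath_iff]
  simp
  grind

lemma no_four_cycle (h : NoCycleOfLength G 4) {a b c d : V}
    (hab : G.Adj a b) (hbc : G.Adj b c) (hcd : G.Adj c d) (hda : G.Adj d a)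
    (hac : a ≠ c) (hbd : b ≠ d) : False := by
  refine h a (.cons hab (.cons hbc (.cons hcd (.cons hda .nil)))) ?_ rfl
  have := hab.ne
  have := hbc.ne
  have := hcd.ne
  have := hda.ne
  simp only [SimpleGraph.Walk.cons_isCycle_iff, SimpleGraph.Walk.cons_isPath_iff]
  simp
  grind

lemma no_five_cycle (h : NoCycleOfLength G 5) {a b c d e : V}
    (hab : G.Adj a b) (hbc : G.Adj b c) (hcd : G.Adj c d) (hde : G.Adj d e) (hea : G.Adj e a)
    (hac : a ≠ c) (had : a ≠ d) (hbd : b ≠ d) (hbe : b ≠ e) (hce : c ≠ e) : False := by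
  refine h a (.cons hab (.cons hbc (.cons hcd (.cons hde (.cons hea .nil))))) ?_ rfl
  have := hab.ne
  have := hbc.ne
  have := hcd.ne
  have := hde.ne
  have := hea.ne
  simp only [SimpleGraph.Walk.cons_isCycle_iff, SimpleGraph.Walk.cons_isPath_iff]
  simp
  grind

end Girth

/-- `S` is a maximal independent set of the subgraph of `G` induced by `A`. -/
def MaxIndepIn {V : Type*} (G : SimpleGraph V) (A S : Set V) : Prop :=
  S ⊆ A ∧ IndepSet G S ∧ ∀ v ∈ A, v ∉ S → ∃ u ∈ S, G.Adj u v

section Independence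

variable {V : Type*} {G : SimpleGraph V}

lemma IndepSet.mono {S T : Set V} (h : IndepSet G T) (hST : S ⊆ T) : IndepSet G S :=
  fun _ ha _ hb => h (hST ha) (hST hb)

lemma maxIndepSet_iff {S : Set V} : MaxIndepSet G S ↔ MaxIndepIn G Set.univ S := by
  constructor
  · rintro ⟨hS, hmax⟩
    refine ⟨Set.subset_univ _, hS, fun v _ hv => ?_⟩
    by_contra! hcon
    have hind : IndepSet G (insert v S) := by
      rintro a (rfl | ha) b (rfl | hb) hab
      · exact hab.ne rfl
      · exact hcon b hb hab.symm
      · exact hcon a ha hab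
      · exact hS ha hb hab
    have := hmax _ hind (Set.subset_insert _ _)
    exact hv (this ▸ Set.mem_insert _ _)
  · rintro ⟨-, hS, hdom⟩
    refine ⟨hS, fun T hT hST => hST.antisymm fun v hv => ?_⟩
    by_contra hvS
    obtain ⟨u, hu, huv⟩ := hdom v trivial hvS
    exact hT (hST hu) hv huv

lemma indepSet_induce_iff {A : Set V} {S : Set A} :
    IndepSet (G.induce A) S ↔ IndepSet G (Subtype.val '' S) := by
  simp [IndepSet]

lemma maxIndepSet_induce_iff {A : Set V} {S : Set A} :
    MaxIndepSet (G.induce A) S ↔ MaxIndepIn G A (Subtype.val '' S) := by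
  rw [maxIndepSet_iff, MaxIndepIn, MaxIndepIn, indepSet_induce_iff]
  simp
  grind

lemma MaxIndepIn.exists_superset [Finite V] {A J : Set V} (hJA : J ⊆ A) (hJ : IndepSet G J) :
    ∃ S, MaxIndepIn G A S ∧ J ⊆ S := by
  obtain ⟨S, hJS, hS⟩ := (Set.toFinite {S : Set V | S ⊆ A ∧ IndepSet G S}).exists_le_maximal
    (show J ∈ {S : Set V | S ⊆ A ∧ IndepSet G S} from ⟨hJA, hJ⟩)
  refine ⟨S, ⟨hS.prop.1, hS.prop.2, fun v hvA hv => ?_⟩, hJS⟩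
  by_contra! hcon
  have hind : IndepSet G (insert v S) := by
    rintro a (rfl | ha) b (rfl | hb) hab
    · exact hab.ne rfl
    · exact hcon b hb hab.symm
    · exact hcon a ha hab
    · exact hS.prop.2 ha hb hab
  exact hv (hS.le_of_ge ⟨Set.insert_subset hvA hS.prop.1, hind⟩ (Set.subset_insert _ _)
    (Set.mem_insert _ _))

lemma ncard_le_alphaNum [Finite V] {S : Set V} (hS : IndepSet G S) : S.ncard ≤ alphaNum G := by
  refine le_csSup ⟨Nat.card V, ?_⟩ ⟨S, hS, rfl⟩
  rintro _ ⟨T, -, rfl⟩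
  exact Set.ncard_le_card T

lemma exists_ncard_eq_alphaNum [Finite V] : ∃ S, IndepSet G S ∧ S.ncard = alphaNum G := by
  refine Nat.sSup_mem (s := {n | ∃ s : Set V, IndepSet G s ∧ s.ncard = n})
    ⟨0, ∅, fun a ha => ha.elim, Set.ncard_empty V⟩ ⟨Nat.card V, ?_⟩
  rintro _ ⟨T, -, rfl⟩
  exact Set.ncard_le_card T

lemma iNum_le_ncard {S : Set V} (hS : MaxIndepSet G S) : iNum G ≤ S.ncard :=
  Nat.sInf_le ⟨S, hS, rfl⟩

lemma exists_ncard_eq_iNum [Finite V] : ∃ S, MaxIndepSet G S ∧ S.ncard = iNum G := by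
  obtain ⟨S, hS, -⟩ := MaxIndepIn.exists_superset (G := G) (Set.empty_subset Set.univ)
    (fun a ha => ha.elim)
  exact Nat.sInf_mem (s := {n | ∃ s : Set V, MaxIndepSet G s ∧ s.ncard = n})
    ⟨_, S, maxIndepSet_iff.2 hS, rfl⟩

lemma exists_maxIndepSet_ncard_eq_alphaNum [Finite V] :
    ∃ S, MaxIndepSet G S ∧ S.ncard = alphaNum G := by
  obtain ⟨S, hS, hc⟩ := exists_ncard_eq_alphaNum (G := G)
  refine ⟨S, ⟨hS, fun T hT hST => Set.eq_of_subset_of_ncard_le hST ?_⟩, hc⟩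
  exact hc ▸ ncard_le_alphaNum hT

lemma ncard_le_alphaNum_induce [Finite V] {A S : Set V} (hSA : S ⊆ A) (hS : IndepSet G S) :
    S.ncard ≤ alphaNum (G.induce A) := by
  obtain ⟨S, rfl⟩ := Set.subset_range_iff_exists_image_eq.1 (hSA.trans Subtype.range_coe.ge)
  rw [Set.ncard_image_of_injective _ Subtype.val_injective]
  exact ncard_le_alphaNum (indepSet_induce_iff.2 hS)

lemma exists_ncard_eq_alphaNum_induce [Finite V] (A : Set V) :
    ∃ S, MaxIndepIn G A S ∧ S.ncard = alphaNum (G.induce A) := by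
  obtain ⟨S, hS, hc⟩ := exists_maxIndepSet_ncard_eq_alphaNum (G := G.induce A)
  exact ⟨_, maxIndepSet_induce_iff.1 hS,
    (Set.ncard_image_of_injective _ Subtype.val_injective).trans hc⟩

lemma iNum_induce_le_ncard {A S : Set V} (hS : MaxIndepIn G A S) :
    iNum (G.induce A) ≤ S.ncard := by
  obtain ⟨S, rfl⟩ := Set.subset_range_iff_exists_image_eq.1 (hS.1.trans Subtype.range_coe.ge)
  rw [Set.ncard_image_of_injective _ Subtype.val_injective]
  exact iNum_le_ncard (maxIndepSet_induce_iff.2 hS)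

lemma exists_ncard_eq_iNum_induce [Finite V] (A : Set V) :
    ∃ S, MaxIndepIn G A S ∧ S.ncard = iNum (G.induce A) := by
  obtain ⟨S, hS, hc⟩ := exists_ncard_eq_iNum (G := G.induce A)
  exact ⟨_, maxIndepSet_induce_iff.1 hS,
    (Set.ncard_image_of_injective _ Subtype.val_injective).trans hc⟩

end Independence

section Types

variable {V : Type*} {G : SimpleGraph V}

lemma mem_completeU_of_adj_s14 {u v : V} (h : G.Adj u v) (hu : u ∈ completeU G) :
    v ∈ completeU G := by
  have : G.connectedComponentMk v = G.connectedComponentMk u :=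
    SimpleGraph.ConnectedComponent.sound h.symm.reachable
  simpa [completeU, this] using hu

lemma HasType.not_isLeaf {v : V} {k : ℕ} (h : HasType G v k) : ¬ IsLeaf G v := by
  rcases h with h | h
  · exact h.1.2
  · exact fun hl => hl.1 h.1

lemma HasType.unique {v : V} {k l : ℕ} (h : HasType G v k) (h' : HasType G v l) : k = l := by
  rcases h with h | h <;> rcases h' with h' | h'
  · exact h.2.symm.trans h'.2
  · exact absurd h'.1 h.1.1
  · exact absurd h.1 h'.1.1
  · exact h.2.trans h'.2.symm

lemma IsLeaf.eq_of_adj_s14 {l u v : V} (hl : IsLeaf G l) (hu : G.Adj l u) (hv : G.Adj l v) :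
    u = v := by
  obtain ⟨w, hw⟩ := Set.ncard_eq_one.1 hl.2
  have key : ∀ z, G.Adj l z → z = w := fun z hz =>
    hw.subset ⟨fun hzU => hl.1 (mem_completeU_of_adj_s14 hz.symm hzU), hz⟩
  rw [key u hu, key v hv]

lemma IsLeaf.not_isLeaf_of_adj {u v : V} (hu : IsLeaf G u) (h : G.Adj u v) : ¬ IsLeaf G v := by
  intro hv
  have key : ∀ w, G.Reachable u w → w = u ∨ w = v := by
    intro w hw
    rw [SimpleGraph.reachable_iff_reflTransGen] at hw
    induction hw with
    | refl => exact .inl rfl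
    | tail _ hbc ih =>
      rcases ih with rfl | rfl
      · exact .inr (hu.eq_of_adj_s14 hbc h)
      · exact .inl (hv.eq_of_adj_s14 hbc h.symm)
  refine hu.1 fun a ha b hb hab => ?_
  have ha' := key a (SimpleGraph.ConnectedComponent.exact ha).symm
  have hb' := key b (SimpleGraph.ConnectedComponent.exact hb).symm
  rcases ha' with rfl | rfl <;> rcases hb' with rfl | rfl
  · exact absurd rfl hab
  · exact h
  · exact h.symm
  · exact absurd rfl hab

lemma IsLeaf.isInternal_of_adj {l u : V} (hl : IsLeaf G l) (h : G.Adj l u) : IsInternal G u :=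
  ⟨fun hu => hl.1 (mem_completeU_of_adj_s14 h.symm hu), hl.not_isLeaf_of_adj h⟩

lemma HasType.not_isLeaf_of_adj [Finite V] {u l : V} (hu : HasType G u 0) (h : G.Adj u l) :
    ¬ IsLeaf G l := by
  intro hl
  have hi := hl.isInternal_of_adj h.symm
  rcases hu with hu | hu
  · exact ((Set.ncard_eq_zero (Set.toFinite _)).1 hu.2).le (show l ∈ _ from ⟨hl, h⟩)
  · exact hi.1 hu.1

lemma HasType.exists_adj_ne {u w : V} (hu : HasType G u 0) (huU : u ∉ completeU G)
    (h : G.Adj u w) : ∃ w', G.Adj u w' ∧ w' ≠ w := by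
  by_contra! hcon
  refine hu.not_isLeaf ⟨huU, Set.ncard_eq_one.2 ⟨w, ?_⟩⟩
  ext z
  refine ⟨fun hz => hcon z hz.2, ?_⟩
  rintro rfl
  exact ⟨fun hw => huU (mem_completeU_of_adj_s14 h.symm hw), h⟩

lemma HasType.exists_leaf {v : V} (hv : HasType G v 1) :
    ∃ l, ∀ m, (IsLeaf G m ∧ G.Adj v m) ↔ m = l := by
  rcases hv with hv | hv
  · obtain ⟨l, hl⟩ := Set.ncard_eq_one.1 hv.2
    exact ⟨l, fun m => Set.ext_iff.1 hl m⟩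
  · exact absurd hv.2 one_ne_zero

lemma HasType.exists_two_leaves {x : V} (hx : HasType G x 2) :
    ∃ l l', l ≠ l' ∧ ∀ m, (IsLeaf G m ∧ G.Adj x m) ↔ m = l ∨ m = l' := by
  rcases hx with hx | hx
  · obtain ⟨l, l', hne, hl⟩ := Set.ncard_eq_two.1 hx.2
    exact ⟨l, l', hne, fun m => by simpa using Set.ext_iff.1 hl m⟩
  · exact absurd hx.2 two_ne_zero

end Types

/-- `x` is the only vertex of type 2 and there are no vertices of larger type. -/
structure UniqueTypeTwo {V : Type*} (G : SimpleGraph V) (x : V) : Prop where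
  hasType : HasType G x 2
  eq_of_hasType : ∀ v, HasType G v 2 → v = x
  not_hasType : ∀ (v : V) (k : ℕ), 3 ≤ k → ¬ HasType G v k

/-- The set `I` together with all leaves not adjacent to it. -/
def addLeaves {V : Type*} (G : SimpleGraph V) (I : Set V) : Set V :=
  I ∪ ({l | IsLeaf G l} \ nbhd G I)

namespace UniqueTypeTwo

variable {V : Type*} {G : SimpleGraph V} {x : V}

lemma hasType_of_isInternal (h : UniqueTypeTwo G x) {v : V} (hv : IsInternal G v) (hvx : v ≠ x) :
    HasType G v 0 ∨ HasType G v 1 := by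
  have key : HasType G v {u | IsLeaf G u ∧ G.Adj v u}.ncard := .inl ⟨hv, rfl⟩
  generalize {u | IsLeaf G u ∧ G.Adj v u}.ncard = k at key
  match k, key with
  | 0, key => exact .inl key
  | 1, key => exact .inr key
  | 2, key => exact absurd (h.eq_of_hasType v key) hvx
  | k + 3, key => exact absurd key (h.not_hasType v _ (by omega))

lemma vertex_cases (h : UniqueTypeTwo G x) (v : V) :
    IsLeaf G v ∨ v ∈ typeSet G 0 ∨ v ∈ insert x (typeSet G 1) := by
  by_cases hvU : v ∈ completeU G
  · exact .inr (.inl (.inr ⟨hvU, rfl⟩))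
  by_cases hl : IsLeaf G v
  · exact .inl hl
  by_cases hvx : v = x
  · exact .inr (.inr (.inl hvx))
  rcases h.hasType_of_isInternal ⟨hvU, hl⟩ hvx with h0 | h1
  · exact .inr (.inl h0)
  · exact .inr (.inr (.inr h1))

lemma not_isLeaf (h : UniqueTypeTwo G x) {v : V} (hv : v ∈ insert x (typeSet G 1)) :
    ¬ IsLeaf G v := by
  rcases hv with rfl | hv
  · exact h.hasType.not_isLeaf
  · exact HasType.not_isLeaf hv

lemma not_mem_typeSet_zero (h : UniqueTypeTwo G x) {v : V} (hv : v ∈ insert x (typeSet G 1)) :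
    v ∉ typeSet G 0 := by
  intro h0
  rcases hv with rfl | hv
  · exact absurd (HasType.unique h0 h.hasType) (by decide)
  · exact absurd (HasType.unique h0 hv) (by decide)

lemma not_mem_typeSet_one (h : UniqueTypeTwo G x) : x ∉ typeSet G 1 :=
  fun h1 => absurd (HasType.unique h1 h.hasType) (by decide)

lemma mem_of_adj_leaf [Finite V] (h : UniqueTypeTwo G x) {l u : V} (hl : IsLeaf G l)
    (hlu : G.Adj l u) : u ∈ insert x (typeSet G 1) := by
  rcases h.vertex_cases u with hu | hu | hu
  · exact absurd hu (hl.not_isLeaf_of_adj hlu)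
  · exact absurd hl (HasType.not_isLeaf_of_adj hu hlu.symm)
  · exact hu

lemma exists_leaf_adj (h : UniqueTypeTwo G x) {v : V} (hv : v ∈ insert x (typeSet G 1)) :
    ∃ l, IsLeaf G l ∧ G.Adj v l := by
  rcases hv with rfl | hv
  · obtain ⟨l, _, -, hl⟩ := h.hasType.exists_two_leaves
    exact ⟨l, (hl l).2 (.inl rfl)⟩
  · obtain ⟨l, hl⟩ := HasType.exists_leaf hv
    exact ⟨l, (hl l).2 rfl⟩

lemma maxIndepSet_union_addLeaves [Finite V] (h : UniqueTypeTwo G x) {I T : Set V}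
    (hind : IndepSet G I)
    (hT : MaxIndepIn G (typeSet G 0 \ nbhd G I) T) : MaxIndepSet G (T ∪ addLeaves G I) := by
  obtain ⟨hTsub, hTind, hTdom⟩ := hT
  refine maxIndepSet_iff.2 ⟨Set.subset_univ _, ?_, fun v _ hv => ?_⟩
  · rintro a (ha | ha | ha) b (hb | hb | hb) hab
    · exact hTind ha hb hab
    · exact (hTsub ha).2 ⟨b, hb, hab.symm⟩
    · exact HasType.not_isLeaf_of_adj (hTsub ha).1 hab hb.1
    · exact (hTsub hb).2 ⟨a, ha, hab⟩
    · exact hind ha hb hab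
    · exact hb.2 ⟨a, ha, hab⟩
    · exact HasType.not_isLeaf_of_adj (hTsub hb).1 hab.symm ha.1
    · exact ha.2 ⟨b, hb, hab.symm⟩
    · exact ha.1.not_isLeaf_of_adj hab hb.1
  · by_cases hvN : v ∈ nbhd G I
    · obtain ⟨u, hu, huv⟩ := hvN
      exact ⟨u, .inr (.inl hu), huv⟩
    rcases h.vertex_cases v with hl | h0 | h1
    · exact absurd (.inr (.inr ⟨hl, hvN⟩)) hv
    · obtain ⟨u, hu, huv⟩ := hTdom v ⟨h0, hvN⟩ fun hvT => hv (.inl hvT)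
      exact ⟨u, .inl hu, huv⟩
    · obtain ⟨l, hl, hvl⟩ := h.exists_leaf_adj h1
      refine ⟨l, .inr (.inr ⟨hl, ?_⟩), hvl.symm⟩
      rintro ⟨u, hu, hul⟩
      exact hv (.inr (.inl (hl.eq_of_adj_s14 hul.symm hvl.symm ▸ hu)))

lemma eq_union_addLeaves [Finite V] (h : UniqueTypeTwo G x) {S : Set V} (hS : MaxIndepSet G S) :
    S = (S ∩ typeSet G 0) ∪ addLeaves G (S ∩ insert x (typeSet G 1)) := by
  obtain ⟨-, hind, hdom⟩ := maxIndepSet_iff.1 hS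
  ext v
  constructor
  · intro hv
    rcases h.vertex_cases v with hl | h0 | h1
    · exact .inr (.inr ⟨hl, fun ⟨u, hu, huv⟩ => hind hu.1 hv huv⟩)
    · exact .inl ⟨hv, h0⟩
    · exact .inr (.inl ⟨hv, h1⟩)
  · rintro (hv | hv | ⟨hl, hvN⟩)
    · exact hv.1
    · exact hv.1
    · by_contra hv
      obtain ⟨u, hu, huv⟩ := hdom v trivial hv
      exact hvN ⟨u, ⟨hu, h.mem_of_adj_leaf hl huv.symm⟩, huv⟩

lemma maxIndepIn_inter_typeSet_zero [Finite V] (h : UniqueTypeTwo G x) {S : Set V}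
    (hS : MaxIndepSet G S) :
    MaxIndepIn G (typeSet G 0 \ nbhd G (S ∩ insert x (typeSet G 1))) (S ∩ typeSet G 0) := by
  obtain ⟨-, hind, hdom⟩ := maxIndepSet_iff.1 hS
  refine ⟨fun v hv => ⟨hv.2, fun ⟨u, hu, huv⟩ => hind hu.1 hv.1 huv⟩,
    hind.mono Set.inter_subset_left, fun v hv hvS => ?_⟩
  obtain ⟨u, hu, huv⟩ := hdom v trivial fun hv' => hvS ⟨hv', hv.1⟩
  rcases h.vertex_cases u with hl | h0 | h1
  · exact absurd hl (HasType.not_isLeaf_of_adj hv.1 huv.symm)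
  · exact ⟨u, ⟨hu, h0⟩, huv⟩
  · exact absurd ⟨u, ⟨hu, h1⟩, huv⟩ hv.2

lemma ncard_union_addLeaves [Finite V] (h : UniqueTypeTwo G x) {I T : Set V}
    (hI : I ⊆ insert x (typeSet G 1)) (hT : T ⊆ typeSet G 0) :
    (T ∪ addLeaves G I).ncard = T.ncard + (addLeaves G I).ncard := by
  refine Set.ncard_union_eq (Set.disjoint_left.2 ?_)
  rintro v hv (hvI | hvl)
  · exact h.not_mem_typeSet_zero (hI hvI) (hT hv)
  · exact HasType.not_isLeaf (hT hv) hvl.1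

lemma ncard_addLeaves_add [Finite V] (h : UniqueTypeTwo G x) {I : Set V}
    (hI : I ⊆ insert x (typeSet G 1)) :
    (addLeaves G I).ncard + ({l | IsLeaf G l} ∩ nbhd G I).ncard =
      I.ncard + {l | IsLeaf G l}.ncard := by
  have hdisj : Disjoint I ({l | IsLeaf G l} \ nbhd G I) :=
    Set.disjoint_left.2 fun v hv hvl => h.not_isLeaf (hI hv) hvl.1
  have := Set.ncard_inter_add_ncard_sdiff_eq_ncard {l | IsLeaf G l} (nbhd G I)
  rw [addLeaves, Set.ncard_union_eq hdisj]
  omega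

/-- A set of vertices of type 1 has as many leaf neighbours as elements. -/
lemma ncard_leaves_inter_nbhd {I : Set V} (hI : I ⊆ typeSet G 1) :
    ({l | IsLeaf G l} ∩ nbhd G I).ncard = I.ncard := by
  have hex : ∀ v, ∃ l, v ∈ typeSet G 1 → ∀ m, (IsLeaf G m ∧ G.Adj v m) ↔ m = l := by
    intro v
    by_cases hv : v ∈ typeSet G 1
    · obtain ⟨l, hl⟩ := HasType.exists_leaf hv
      exact ⟨l, fun _ => hl⟩
    · exact ⟨v, fun hv' => absurd hv' hv⟩
  choose f hf using hex
  have himage : {l | IsLeaf G l} ∩ nbhd G I = f '' I := by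
    ext l
    constructor
    · rintro ⟨hl, u, hu, hul⟩
      exact ⟨u, hu, ((hf u (hI hu) l).1 ⟨hl, hul⟩).symm⟩
    · rintro ⟨u, hu, rfl⟩
      have := (hf u (hI hu) _).2 rfl
      exact ⟨this.1, u, hu, this.2⟩
  rw [himage]
  refine Set.InjOn.ncard_image fun u hu v hv huv => ?_
  have h1 := (hf u (hI hu) _).2 rfl
  have h2 := (hf v (hI hv) _).2 rfl
  rw [← huv] at h2
  exact h1.1.eq_of_adj_s14 h1.2.symm h2.2.symm

lemma ncard_addLeaves [Finite V] (h : UniqueTypeTwo G x) {I : Set V} (hI : I ⊆ typeSet G 1) :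
    (addLeaves G I).ncard = {l | IsLeaf G l}.ncard := by
  have := h.ncard_addLeaves_add (hI.trans (Set.subset_insert _ _))
  rw [ncard_leaves_inter_nbhd hI] at this
  omega

lemma ncard_addLeaves_insert [Finite V] (h : UniqueTypeTwo G x) {I : Set V}
    (hI : I ⊆ typeSet G 1) :
    (addLeaves G (insert x I)).ncard + 1 = {l | IsLeaf G l}.ncard := by
  have hsum := h.ncard_addLeaves_add (Set.insert_subset_insert (a := x) hI)
  have hxI : x ∉ I := fun hx => h.not_mem_typeSet_one (hI hx)
  obtain ⟨l, l', hne, hl⟩ := h.hasType.exists_two_leaves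
  have hunion : {l | IsLeaf G l} ∩ nbhd G (insert x I) =
      ({l | IsLeaf G l} ∩ nbhd G I) ∪ {l, l'} := by
    ext m
    constructor
    · rintro ⟨hm, u, rfl | hu, hum⟩
      · exact .inr ((hl m).1 ⟨hm, hum⟩)
      · exact .inl ⟨hm, u, hu, hum⟩
    · rintro (⟨hm, u, hu, hum⟩ | hm)
      · exact ⟨hm, u, .inr hu, hum⟩
      · have := (hl m).2 hm
        exact ⟨this.1, x, .inl rfl, this.2⟩
  have hdisj : Disjoint ({l | IsLeaf G l} ∩ nbhd G I) {l, l'} := by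
    refine Set.disjoint_left.2 ?_
    rintro m ⟨hm, u, hu, hum⟩ hm'
    have := IsLeaf.eq_of_adj_s14 hm hum.symm ((hl m).2 hm').2.symm
    exact hxI (this ▸ hu)
  rw [hunion, Set.ncard_union_eq hdisj, ncard_leaves_inter_nbhd hI, Set.ncard_pair hne,
    Set.ncard_insert_of_notMem hxI] at hsum
  omega

lemma alphaNum_eq [Finite V] (h : UniqueTypeTwo G x) :
    alphaNum G = alphaNum (G.induce (typeSet G 0)) + {l | IsLeaf G l}.ncard := by
  apply le_antisymm
  · obtain ⟨S, hS, hc⟩ := exists_maxIndepSet_ncard_eq_alphaNum (G := G)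
    have hcard := h.ncard_union_addLeaves (I := S ∩ insert x (typeSet G 1)) (T := S ∩ typeSet G 0)
      Set.inter_subset_right Set.inter_subset_right
    rw [← h.eq_union_addLeaves hS] at hcard
    have h0 := ncard_le_alphaNum_induce (A := typeSet G 0) Set.inter_subset_right
      (hS.1.mono (Set.inter_subset_left (t := typeSet G 0)))
    have hI : (addLeaves G (S ∩ insert x (typeSet G 1))).ncard ≤ {l | IsLeaf G l}.ncard := by
      by_cases hx : x ∈ S
      · rw [Set.inter_insert_of_mem hx]
        have := h.ncard_addLeaves_insert (I := S ∩ typeSet G 1) Set.inter_subset_right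
        omega
      · rw [Set.inter_insert_of_notMem hx]
        exact (h.ncard_addLeaves Set.inter_subset_right).le
    omega
  · obtain ⟨T, hT, hc⟩ := exists_ncard_eq_alphaNum_induce (G := G) (typeSet G 0)
    have hT' : MaxIndepIn G (typeSet G 0 \ nbhd G ∅) T := by simpa [nbhd] using hT
    have hmax := h.maxIndepSet_union_addLeaves (fun a ha => ha.elim) hT'
    have hcard := h.ncard_union_addLeaves (Set.empty_subset _) hT.1
    rw [h.ncard_addLeaves (Set.empty_subset _)] at hcard
    have := ncard_le_alphaNum hmax.1
    omega

lemma iNum_le [Finite V] (h : UniqueTypeTwo G x) {I T : Set V} (hI : I ⊆ typeSet G 1)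
    (hind : IndepSet G I) (hT : MaxIndepIn G (typeSet G 0 \ nbhd G I) T) :
    iNum G ≤ T.ncard + {l | IsLeaf G l}.ncard := by
  have hI' := hI.trans (Set.subset_insert x _)
  have := iNum_le_ncard (h.maxIndepSet_union_addLeaves hind hT)
  rwa [h.ncard_union_addLeaves hI' (hT.1.trans Set.sdiff_subset), h.ncard_addLeaves hI] at this

lemma iNum_add_one_le [Finite V] (h : UniqueTypeTwo G x) {I T : Set V} (hI : I ⊆ typeSet G 1)
    (hind : IndepSet G (insert x I))
    (hT : MaxIndepIn G (typeSet G 0 \ nbhd G (insert x I)) T) :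
    iNum G + 1 ≤ T.ncard + {l | IsLeaf G l}.ncard := by
  have hI' := Set.insert_subset_insert (a := x) hI
  have := iNum_le_ncard (h.maxIndepSet_union_addLeaves hind hT)
  rw [h.ncard_union_addLeaves hI' (hT.1.trans Set.sdiff_subset)] at this
  have := h.ncard_addLeaves_insert hI
  omega

lemma indepSet_insert {I : Set V} (hind : IndepSet G I)
    (hI : I ∩ G.neighborSet x = ∅) : IndepSet G (insert x I) := by
  have key : ∀ v ∈ I, ¬ G.Adj x v := fun v hv hxv => hI.le (show v ∈ _ from ⟨hv, hxv⟩)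
  rintro a (rfl | ha) b (rfl | hb) hab
  · exact hab.ne rfl
  · exact key b hb hab
  · exact key a ha hab.symm
  · exact hind ha hb hab

lemma diff_nbhd_insert (hN : ∀ u ∈ G.neighborSet x, u ∉ typeSet G 0) (I : Set V) :
    typeSet G 0 \ nbhd G (insert x I) = typeSet G 0 \ nbhd G I := by
  ext v
  refine ⟨fun hv => ⟨hv.1, fun ⟨u, hu, huv⟩ => hv.2 ⟨u, .inr hu, huv⟩⟩, fun hv => ⟨hv.1, ?_⟩⟩
  rintro ⟨u, rfl | hu, huv⟩
  · exact hN v huv hv.1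
  · exact hv.2 ⟨u, hu, huv⟩

/-- If removing the neighbours of `x` and of any compatible set of type-1 vertices never
decreases the size of maximal independent sets of `G_0` below `α(G_0)`, then `x` has no
neighbour of type 0. -/
lemma not_mem_typeSet_zero_of_adj [Finite V] (h : UniqueTypeTwo G x) (hg : GirthAtLeastSix G)
    (hmax : ∀ I T : Set V, I ⊆ typeSet G 1 → IndepSet G (insert x I) →
      MaxIndepIn G (typeSet G 0 \ nbhd G (insert x I)) T →
      alphaNum (G.induce (typeSet G 0)) ≤ T.ncard)
    {u : V} (hxu : G.Adj x u) : u ∉ typeSet G 0 := by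
  intro hu
  obtain ⟨hg3, hg4, hg5⟩ := hg
  have hxU : x ∉ completeU G := by
    rcases h.hasType with hx | hx
    · exact hx.1.1
    · exact absurd hx.2 two_ne_zero
  have huU : u ∉ completeU G := fun hu' => hxU (mem_completeU_of_adj_s14 hxu.symm hu')
  have hex : ∀ w, ∃ w', G.Adj u w → w ∈ typeSet G 0 → G.Adj w w' ∧ w' ≠ u := by
    intro w
    by_cases hw : G.Adj u w ∧ w ∈ typeSet G 0
    · obtain ⟨w', hw'⟩ := HasType.exists_adj_ne hw.2
        (fun hwU => huU (mem_completeU_of_adj_s14 hw.1.symm hwU)) hw.1.symm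
      exact ⟨w', fun _ _ => hw'⟩
    · exact ⟨w, fun h1 h2 => absurd ⟨h1, h2⟩ hw⟩
  choose g hadj using hex
  set J : Set V := g '' {w | G.Adj u w ∧ w ∈ typeSet G 0}
  have hJx : ∀ v ∈ J, ¬ G.Adj x v := by
    rintro _ ⟨w, ⟨huw, hw⟩, rfl⟩ hxv
    obtain ⟨h1, h2⟩ := hadj w huw hw
    refine no_four_cycle hg4 hxu huw h1 hxv.symm ?_ h2.symm
    rintro rfl
    exact h.not_mem_typeSet_zero (.inl rfl) hw
  have hJind : IndepSet G J := by
    rintro _ ⟨w, ⟨huw, hw⟩, rfl⟩ _ ⟨z, ⟨huz, hz⟩, rfl⟩ hwz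
    obtain ⟨hw1, hw2⟩ := hadj w huw hw
    obtain ⟨hz1, hz2⟩ := hadj z huz hz
    have hne : w ≠ z := by
      rintro rfl
      exact hwz.ne rfl
    refine no_five_cycle hg5 huw hw1 hwz hz1.symm huz.symm hw2.symm hz2.symm ?_ hne ?_
    · intro heq
      exact no_triangle hg3 huw (heq ▸ hz1.symm) huz.symm
    · intro heq
      exact no_triangle hg3 huw (heq ▸ hw1) huz.symm
  have hJcases : ∀ v ∈ J, v ∈ typeSet G 0 ∨ v ∈ typeSet G 1 := by
    rintro _ ⟨w, ⟨huw, hw⟩, rfl⟩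
    obtain ⟨hw1, hw2⟩ := hadj w huw hw
    rcases h.vertex_cases (g w) with hl | h0 | rfl | h1
    · exact absurd hl (HasType.not_isLeaf_of_adj hw hw1)
    · exact .inl h0
    · exact (no_triangle hg3 huw hw1 hxu).elim
    · exact .inr h1
  have hIind : IndepSet G (insert x (J ∩ typeSet G 1)) := by
    refine indepSet_insert (hJind.mono Set.inter_subset_left) ?_
    exact Set.eq_empty_of_forall_notMem fun v hv => hJx v hv.1.1 hv.2
  obtain ⟨S, hS, hJS⟩ := MaxIndepIn.exists_superset (G := G) (J := J ∩ typeSet G 0)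
    (A := typeSet G 0 \ nbhd G (insert x (J ∩ typeSet G 1)))
    (by
      rintro v ⟨hvJ, hv0⟩
      refine ⟨hv0, ?_⟩
      rintro ⟨z, rfl | hz, hzv⟩
      · exact hJx v hvJ hzv
      · exact hJind hz.1 hvJ hzv)
    (hJind.mono Set.inter_subset_left)
  have hle := hmax _ S Set.inter_subset_right hIind hS
  have huS : u ∉ S := fun huS => (hS.1 huS).2 ⟨x, .inl rfl, hxu⟩
  have hnadj : ∀ w ∈ S, ¬ G.Adj u w := by
    intro w hwS huw
    have hw0 := (hS.1 hwS).1
    have hgJ : g w ∈ J := ⟨w, ⟨huw, hw0⟩, rfl⟩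
    have hw1 := (hadj w huw hw0).1
    rcases hJcases _ hgJ with h0 | h1
    · exact hS.2.1 hwS (hJS ⟨hgJ, h0⟩) hw1
    · exact (hS.1 hwS).2 ⟨g w, .inr ⟨hgJ, h1⟩, hw1.symm⟩
  have hind : IndepSet G (insert u S) := by
    rintro a (rfl | ha) b (rfl | hb) hab
    · exact hab.ne rfl
    · exact hnadj b hb hab
    · exact hnadj a ha hab.symm
    · exact hS.2.1 ha hb hab
  have := ncard_le_alphaNum_induce (Set.insert_subset hu (hS.1.trans Set.sdiff_subset)) hind
  rw [Set.ncard_insert_of_notMem huS] at this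
  omega

end UniqueTypeTwo

/-- Characterization of almost well-covered graphs of girth at least 6 with
exactly one vertex `x` of type 2 (and no vertices of type `k ≥ 3`). -/
theorem one_type2_characterization {V : Type*} [Fintype V] (G : SimpleGraph V)
    (hg : GirthAtLeastSix G)
    (x : V) (hx : HasType G x 2) (honly : ∀ v : V, HasType G v 2 → v = x)
    (hno3 : ∀ (v : V) (k : ℕ), 3 ≤ k → ¬ HasType G v k) :
    AlmostWellCovered G ↔
      (∀ v : V, IsInternal G v → v ≠ x → (HasType G v 0 ∨ HasType G v 1)) ∧
      (∀ u ∈ G.neighborSet x, u ∉ typeSet G 0) ∧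
      WellCovered (G.induce (typeSet G 0)) ∧
      ∀ I : Set V, IndepSet G I → I ⊆ typeSet G 1 →
        ((I ∩ G.neighborSet x = ∅ →
            alphaNum (G.induce (typeSet G 0)) =
              iNum (G.induce (typeSet G 0 \ nbhd G I))) ∧
         (I ∩ G.neighborSet x ≠ ∅ →
            alphaNum (G.induce (typeSet G 0)) -
              iNum (G.induce (typeSet G 0 \ nbhd G I)) ≤ 1)) := by
  have h : UniqueTypeTwo G x := ⟨hx, honly, hno3⟩
  have hα := h.alphaNum_eq
  have hempty : IndepSet G ∅ := fun a ha => ha.elim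
  rw [AlmostWellCovered, indepGap]
  constructor
  · intro hgap
    have hN : ∀ u ∈ G.neighborSet x, u ∉ typeSet G 0 := fun u hu =>
      h.not_mem_typeSet_zero_of_adj hg (fun I T hI hind hT => by
        have := h.iNum_add_one_le hI hind hT
        omega) hu
    have ha : ∀ I : Set V, IndepSet G I → I ⊆ typeSet G 1 → I ∩ G.neighborSet x = ∅ →
        alphaNum (G.induce (typeSet G 0)) = iNum (G.induce (typeSet G 0 \ nbhd G I)) := by
      intro I hind hI hIx
      obtain ⟨T, hT, hc⟩ := exists_ncard_eq_iNum_induce (G := G) (typeSet G 0 \ nbhd G I)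
      have hle := ncard_le_alphaNum_induce (hT.1.trans Set.sdiff_subset) hT.2.1
      rw [← UniqueTypeTwo.diff_nbhd_insert hN] at hT
      have := h.iNum_add_one_le hI (UniqueTypeTwo.indepSet_insert hind hIx) hT
      omega
    refine ⟨fun v hv hvx => h.hasType_of_isInternal hv hvx, hN, ?_, fun I hind hI =>
      ⟨ha I hind hI, fun _ => ?_⟩⟩
    · have := ha ∅ hempty (Set.empty_subset _) (Set.empty_inter _)
      have hdiff : typeSet G 0 \ nbhd G ∅ = typeSet G 0 := by simp [nbhd]
      rwa [hdiff] at this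
    · obtain ⟨T, hT, hc⟩ := exists_ncard_eq_iNum_induce (G := G) (typeSet G 0 \ nbhd G I)
      have := h.iNum_le hI hind hT
      omega
  · rintro ⟨-, hN, -, hI⟩
    have hle : iNum G + 1 ≤ alphaNum G := by
      obtain ⟨T, hT, hc⟩ := exists_ncard_eq_iNum_induce (G := G) (typeSet G 0 \ nbhd G ∅)
      have heq := (hI ∅ hempty (Set.empty_subset _)).1 (Set.empty_inter _)
      rw [← UniqueTypeTwo.diff_nbhd_insert hN] at hT
      have := h.iNum_add_one_le (Set.empty_subset _)
        (UniqueTypeTwo.indepSet_insert hempty (Set.empty_inter _)) hT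
      omega
    obtain ⟨S, hS, hc⟩ := exists_ncard_eq_iNum (G := G)
    have hcard := h.ncard_union_addLeaves (I := S ∩ insert x (typeSet G 1)) (T := S ∩ typeSet G 0)
      Set.inter_subset_right Set.inter_subset_right
    rw [← h.eq_union_addLeaves hS] at hcard
    have hT := h.maxIndepIn_inter_typeSet_zero hS
    obtain ⟨hdisj, hmeet⟩ := hI (S ∩ typeSet G 1) (hS.1.mono Set.inter_subset_left)
      Set.inter_subset_right
    by_cases hxS : x ∈ S
    · rw [Set.inter_insert_of_mem hxS] at hcard hT
      rw [UniqueTypeTwo.diff_nbhd_insert hN] at hT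
      have hL := h.ncard_addLeaves_insert (I := S ∩ typeSet G 1) Set.inter_subset_right
      have heq := hdisj (Set.eq_empty_of_forall_notMem fun v hv => hS.1 hxS hv.1.1 hv.2)
      have := iNum_induce_le_ncard hT
      omega
    · rw [Set.inter_insert_of_notMem hxS] at hcard hT
      have hL := h.ncard_addLeaves (I := S ∩ typeSet G 1) Set.inter_subset_right
      have := iNum_induce_le_ncard hT
      by_cases hSx : S ∩ typeSet G 1 ∩ G.neighborSet x = ∅
      · have := hdisj hSx
        omega
      · have := hmeet hSx
        omega
end
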